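/- The supremum I_{1,∞} := sup_{ω∈K_{1,∞}} E(ω) is finite, and it is attained: there exists ω ∈ K_{1,∞} such that E(ω') ≤ E(ω) for every ω' ∈ K_{1,∞}. -/

import Mathlib

open MeasureTheory Real Set NNReal Filter Topology

noncomputable section

/-- The upper half plane `ℝ²₊`. -/
def H : Set (ℝ × ℝ) := {p | 0 < p.2}

/-- The half-plane Green function
`G(x,y) = (1/(4π)) log(1 + 4 x₂ y₂ / |x-y|²)` (Euclidean distance). -/
def G (x y : ℝ × ℝ) : ℝ :=
  (1 / (4 * π)) * Real.log (1 + 4 * x.2 * y.2 / ((x.1 - y.1) ^ 2 + (x.2 - y.2) ^ 2))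

/-- The potential `𝒢[ω](x) = ∫_{ℝ²₊} G(x,y) ω(y) dy`. -/
def Gpot (ω : ℝ × ℝ → ℝ) (x : ℝ × ℝ) : ℝ := ∫ y in H, G x y * ω y

/-- The kinetic energy `E(ω) = (1/2) ∫∫ G(x,y) ω(x) ω(y) dy dx`. -/
def energy (ω : ℝ × ℝ → ℝ) : ℝ :=
  (1 / 2) * ∫ x in H, ∫ y in H, G x y * ω x * ω y

/-- The `L¹(ℝ²₊)` norm (mass). -/
def norm1 (ω : ℝ × ℝ → ℝ) : ℝ := ∫ x in H, |ω x|

/-- The `L²(ℝ²₊)` norm. -/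
def norm2 (ω : ℝ × ℝ → ℝ) : ℝ := (∫ x in H, ω x ^ 2) ^ ((1 : ℝ) / 2)

/-- The impulse `‖x₂ ω‖₁ = ∫_{ℝ²₊} x₂ |ω(x)| dx`. -/
def impulse (ω : ℝ × ℝ → ℝ) : ℝ := ∫ x in H, x.2 * |ω x|

/-- `ω ∈ (L¹ ∩ L²)(ℝ²₊)`. -/
def MemL1L2 (ω : ℝ × ℝ → ℝ) : Prop :=
  Integrable ω (volume.restrict H) ∧ Integrable (fun x => ω x ^ 2) (volume.restrict H)

/-- Finiteness of the impulse `‖x₂ ω‖₁ < ∞`. -/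
def ImpulseFinite (ω : ℝ × ℝ → ℝ) : Prop :=
  Integrable (fun x : ℝ × ℝ => x.2 * |ω x|) (volume.restrict H)

/-- The admissible class `K_M`: patches `ω = 1_A` a.e. on `ℝ²₊` with
impulse `∫_A x₂ = M` and mass `|A| ≤ 1`. -/
def memK (M : ℝ) (ω : ℝ × ℝ → ℝ) : Prop :=
  Integrable ω (volume.restrict H) ∧
  ∃ A : Set (ℝ × ℝ), A ⊆ H ∧ MeasurableSet A ∧
    (∀ᵐ x ∂volume.restrict H, ω x = A.indicator (fun _ => (1 : ℝ)) x) ∧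
    (∫ x in A, x.2) = M ∧ volume A ≤ 1

/-- The admissible class `K_{M,∞}`: patches `ω = 1_A` a.e. on `ℝ²₊` with
impulse `∫_A x₂ = M`, without any mass bound. -/
def memKinf (M : ℝ) (ω : ℝ × ℝ → ℝ) : Prop :=
  Integrable ω (volume.restrict H) ∧
  ∃ A : Set (ℝ × ℝ), A ⊆ H ∧ MeasurableSet A ∧
    (∀ᵐ x ∂volume.restrict H, ω x = A.indicator (fun _ => (1 : ℝ)) x) ∧
    (∫ x in A, x.2) = M

/-- The relaxed admissible class `K̃_M`: measurable `0 ≤ ω ≤ 1` with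
mass `≤ 1` and impulse `≤ M`. -/
def memKt (M : ℝ) (ω : ℝ × ℝ → ℝ) : Prop :=
  Integrable ω (volume.restrict H) ∧
  (∀ᵐ x ∂volume.restrict H, 0 ≤ ω x ∧ ω x ≤ 1) ∧
  norm1 ω ≤ 1 ∧
  Integrable (fun x : ℝ × ℝ => x.2 * |ω x|) (volume.restrict H) ∧
  impulse ω ≤ M

/-- The set of maximizers `S_M` of the energy over `K_M`. -/
def memS (M : ℝ) (ω : ℝ × ℝ → ℝ) : Prop :=
  memK M ω ∧ ∀ ω' : ℝ × ℝ → ℝ, memK M ω' → energy ω' ≤ energy ω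

/-- The maximal energy `I_M` over `K_M`. -/
def Isup (M : ℝ) : ℝ := sSup (energy '' {ω | memK M ω})

/-- The maximal energy `I_{1,∞}` over `K_{1,∞}`. -/
def IsupInf : ℝ := sSup (energy '' {ω | memKinf 1 ω})

/-- The Steiner symmetry condition for a set `Ω ⊆ ℝ²₊`. -/
def SteinerSet (Ω : Set (ℝ × ℝ)) : Prop :=
  (∀ x₁ x₂ : ℝ, 0 < x₂ → (((x₁, x₂) : ℝ × ℝ) ∈ Ω ↔ ((-x₁, x₂) : ℝ × ℝ) ∈ Ω)) ∧
  (∀ x₂ : ℝ, 0 < x₂ → ∀ a b : ℝ, 0 ≤ a → a ≤ b →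
    ((b, x₂) : ℝ × ℝ) ∈ Ω → ((a, x₂) : ℝ × ℝ) ∈ Ω)

/-- The Steiner symmetry condition for a nonnegative function on `ℝ²₊`. -/
def SteinerFn (f : ℝ × ℝ → ℝ) : Prop :=
  (∀ x₁ x₂ : ℝ, 0 < x₂ → f (x₁, x₂) = f (-x₁, x₂)) ∧
  (∀ x₂ : ℝ, 0 < x₂ → ∀ a b : ℝ, 0 ≤ a → a ≤ b → f (b, x₂) ≤ f (a, x₂))

theorem measurableSet_H : MeasurableSet H := measurableSet_lt measurable_const measurable_snd

theorem G_comm (x y : ℝ × ℝ) : G x y = G y x := by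
  unfold G
  rw [show (x.1 - y.1) ^ 2 = (y.1 - x.1) ^ 2 by ring,
    show (x.2 - y.2) ^ 2 = (y.2 - x.2) ^ 2 by ring,
    show 4 * x.2 * y.2 = 4 * y.2 * x.2 by ring]

theorem measurable_G : Measurable (fun p : (ℝ × ℝ) × (ℝ × ℝ) => G p.1 p.2) := by
  unfold G
  fun_prop

theorem norm_sq_le_dist (x y : ℝ × ℝ) :
    ‖x - y‖ ^ 2 ≤ (x.1 - y.1) ^ 2 + (x.2 - y.2) ^ 2 := by
  rw [Prod.norm_def]
  rcases max_choice ‖(x - y).1‖ ‖(x - y).2‖ with h | h <;> rw [h] <;>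
    simp only [Prod.fst_sub, Prod.snd_sub, Real.norm_eq_abs, sq_abs] <;>
    nlinarith [sq_nonneg (x.1 - y.1), sq_nonneg (x.2 - y.2)]

theorem dist_le_two_norm_sq (x y : ℝ × ℝ) :
    (x.1 - y.1) ^ 2 + (x.2 - y.2) ^ 2 ≤ 2 * ‖x - y‖ ^ 2 := by
  have h1 : (x.1 - y.1) ^ 2 ≤ ‖x - y‖ ^ 2 := by
    have := norm_fst_le (x - y)
    rw [← sq_abs (x.1 - y.1)]
    exact pow_le_pow_left₀ (abs_nonneg _) this 2
  have h2 : (x.2 - y.2) ^ 2 ≤ ‖x - y‖ ^ 2 := by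
    have := norm_snd_le (x - y)
    rw [← sq_abs (x.2 - y.2)]
    exact pow_le_pow_left₀ (abs_nonneg _) this 2
  linarith

theorem G_nonneg {x y : ℝ × ℝ} (hx : x ∈ H) (hy : y ∈ H) : 0 ≤ G x y := by
  have hx : 0 < x.2 := hx
  have hy : 0 < y.2 := hy
  unfold G
  refine mul_nonneg (by positivity) (Real.log_nonneg ?_)
  have : 0 ≤ 4 * x.2 * y.2 / ((x.1 - y.1) ^ 2 + (x.2 - y.2) ^ 2) := by positivity
  linarith

theorem G_le_log {x y : ℝ × ℝ} (hx : x ∈ H) (hy : y ∈ H) {d : ℝ} (hd : 0 < d)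
    (hxy : d ≤ ‖x - y‖) : G x y ≤ (1 / (4 * π)) * Real.log (1 + 4 * x.2 * y.2 / d ^ 2) := by
  have hx : 0 < x.2 := hx
  have hy : 0 < y.2 := hy
  unfold G
  have h1 : d ^ 2 ≤ (x.1 - y.1) ^ 2 + (x.2 - y.2) ^ 2 :=
    (pow_le_pow_left₀ hd.le hxy 2).trans (norm_sq_le_dist x y)
  have h2 : 4 * x.2 * y.2 / ((x.1 - y.1) ^ 2 + (x.2 - y.2) ^ 2) ≤ 4 * x.2 * y.2 / d ^ 2 :=
    div_le_div_of_nonneg_left (by positivity) (by positivity) h1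
  have h3 : 0 ≤ 4 * x.2 * y.2 / ((x.1 - y.1) ^ 2 + (x.2 - y.2) ^ 2) := by positivity
  gcongr

theorem G_le_mul_div_sq {x y : ℝ × ℝ} (hx : x ∈ H) (hy : y ∈ H) {d : ℝ} (hd : 0 < d)
    (hxy : d ≤ ‖x - y‖) : G x y ≤ x.2 * ((d ^ 2)⁻¹ * y.2) := by
  have h := G_le_log hx hy hd hxy
  have hx : 0 < x.2 := hx
  have hy : 0 < y.2 := hy
  have h4 : Real.log (1 + 4 * x.2 * y.2 / d ^ 2) ≤ 4 * x.2 * y.2 / d ^ 2 := by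
    have := Real.log_le_sub_one_of_pos (x := 1 + 4 * x.2 * y.2 / d ^ 2) (by positivity)
    linarith
  have h5 : (1 / (4 * π)) * Real.log (1 + 4 * x.2 * y.2 / d ^ 2)
      ≤ (1 / (4 * 1)) * (4 * x.2 * y.2 / d ^ 2) := by
    refine mul_le_mul ?_ h4 (Real.log_nonneg ?_) (by norm_num)
    · gcongr; linarith [Real.pi_gt_three]
    · have : 0 ≤ 4 * x.2 * y.2 / d ^ 2 := by positivity
      linarith
  calc _ ≤ _ := h
    _ ≤ _ := h5
    _ = _ := by field_simp

theorem G_le_div_norm {x y : ℝ × ℝ} (hx : x ∈ H) (hy : y ∈ H) :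
    G x y ≤ x.2 * ‖x - y‖⁻¹ := by
  rcases eq_or_ne x y with rfl | hne
  · simp [G]
  have hd : 0 < ‖x - y‖ := norm_pos_iff.2 (sub_ne_zero.2 hne)
  have h := G_le_log hx hy hd le_rfl
  have hx : 0 < x.2 := hx
  have hy : 0 < y.2 := hy
  set d := ‖x - y‖ with hdd
  have hyx : y.2 ≤ x.2 + d := by
    have h1 := norm_snd_le (x - y)
    rw [Prod.snd_sub, Real.norm_eq_abs] at h1
    have := neg_abs_le (x.2 - y.2)
    linarith
  have hq : 1 + 4 * x.2 * y.2 / d ^ 2 ≤ (1 + 2 * (x.2 * d⁻¹)) ^ 2 := by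
    have : 4 * x.2 * y.2 / d ^ 2 ≤ 4 * x.2 * (x.2 + d) / d ^ 2 := by gcongr
    refine (add_le_add_right this 1).trans (le_of_eq ?_)
    field_simp
    ring
  have h4 : Real.log (1 + 4 * x.2 * y.2 / d ^ 2) ≤ 4 * (x.2 * d⁻¹) := by
    refine (Real.log_le_log (by positivity) hq).trans ?_
    rw [Real.log_pow]
    have := Real.log_le_sub_one_of_pos (x := 1 + 2 * (x.2 * d⁻¹)) (by positivity)
    push_cast
    linarith
  have h5 : (1 / (4 * π)) * Real.log (1 + 4 * x.2 * y.2 / d ^ 2)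
      ≤ (1 / (4 * 1)) * (4 * (x.2 * d⁻¹)) := by
    refine mul_le_mul ?_ h4 (Real.log_nonneg ?_) (by norm_num)
    · gcongr; linarith [Real.pi_gt_three]
    · have : 0 ≤ 4 * x.2 * y.2 / d ^ 2 := by positivity
      linarith
  linarith

theorem log_le_G {x y : ℝ × ℝ} {c d : ℝ} (hc : 0 < c) (hx : c ≤ x.2) (hy : c ≤ y.2)
    (hne : x ≠ y) (hxy : ‖x - y‖ ≤ d) :
    (1 / (4 * π)) * Real.log (1 + 2 * c ^ 2 / d ^ 2) ≤ G x y := by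
  unfold G
  have hd : 0 < ‖x - y‖ := norm_pos_iff.2 (sub_ne_zero.2 hne)
  have h1 : (x.1 - y.1) ^ 2 + (x.2 - y.2) ^ 2 ≤ 2 * d ^ 2 :=
    (dist_le_two_norm_sq x y).trans (by gcongr)
  have h0 : 0 < (x.1 - y.1) ^ 2 + (x.2 - y.2) ^ 2 :=
    lt_of_lt_of_le (by positivity) (norm_sq_le_dist x y)
  have hd' : 0 < d := hd.trans_le hxy
  have h2 : 2 * c ^ 2 / d ^ 2 ≤ 4 * x.2 * y.2 / ((x.1 - y.1) ^ 2 + (x.2 - y.2) ^ 2) := by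
    calc 2 * c ^ 2 / d ^ 2 = 4 * c * c / (2 * d ^ 2) := by field_simp; ring
      _ ≤ _ := by
        have hx0 : 0 ≤ x.2 := hc.le.trans hx
        have hy0 : 0 ≤ y.2 := hc.le.trans hy
        have : 0 ≤ 4 * x.2 * y.2 := by positivity
        gcongr
  gcongr

theorem lintegral_ball_inv_norm_le (x : ℝ × ℝ) (s : ℝ) (hs : 0 < s) :
    ∫⁻ y in Metric.ball x s, ENNReal.ofReal (‖x - y‖⁻¹) ≤ ENNReal.ofReal (8 * s) := by
  have hball : (volume : Measure (ℝ × ℝ)).real (Metric.ball 0 1) = 4 := by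
    rw [show (0 : ℝ × ℝ) = ((0 : ℝ), (0 : ℝ)) from rfl, ← ball_prod_same,
      measureReal_def, Measure.volume_eq_prod, Measure.prod_prod]
    simp; norm_num
  have hdim : Module.finrank ℝ (ℝ × ℝ) = 2 := by simp
  have hinteg : IntegrableOn (fun y : ℝ × ℝ => ‖y‖⁻¹) (Metric.ball 0 s) volume := by
    rw [integrableOn_fun_norm_addHaar volume (f := fun t => t⁻¹), hdim]
    refine (integrableOn_const (C := (1:ℝ)) (by simp)).congr_fun ?_ measurableSet_Ioo
    intro t ht
    have : t ≠ 0 := ht.1.ne'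
    simp [this]
  have key : ∫ y in Metric.ball (0 : ℝ × ℝ) s, ‖y‖⁻¹ = 8 * s := by
    have := integral_fun_norm_addHaar (volume : Measure (ℝ × ℝ)) ((Iio s).indicator fun t => t⁻¹)
    rw [hdim, hball] at this
    have e : (fun x : ℝ × ℝ => (Iio s).indicator (fun t => t⁻¹) ‖x‖)
        = (Metric.ball (0 : ℝ × ℝ) s).indicator fun x => ‖x‖⁻¹ := by
      ext x; simp [indicator]
    rw [e, integral_indicator measurableSet_ball] at this
    rw [this]
    have e2 : ∫ y in Ioi (0:ℝ), y ^ (2 - 1) • (Iio s).indicator (fun t => t⁻¹) y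
        = ∫ y in Ioi (0:ℝ), (Iio s).indicator (fun _ => (1:ℝ)) y := by
      refine setIntegral_congr_fun measurableSet_Ioi ?_
      intro t ht
      have : t ≠ 0 := (mem_Ioi.1 ht).ne'
      by_cases h : t < s <;> simp [indicator, h, this]
    rw [e2, setIntegral_indicator measurableSet_Iio]
    simp [hs.le, Ioi_inter_Iio]
    ring
  have e3 : ∫⁻ y in Metric.ball x s, ENNReal.ofReal (‖x - y‖⁻¹)
      = ∫⁻ y in Metric.ball (0 : ℝ × ℝ) s, ENNReal.ofReal (‖y‖⁻¹) := by
    rw [← lintegral_indicator measurableSet_ball, ← lintegral_indicator measurableSet_ball,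
      ← lintegral_sub_left_eq_self _ x]
    congr 1; ext y
    simp [indicator, dist_eq_norm]
  rw [e3, ← ofReal_integral_eq_lintegral_ofReal hinteg (ae_of_all _ fun y => by positivity), key]

/-- Lebesgue measure on the half-plane. -/
abbrev volH : Measure (ℝ × ℝ) := volume.restrict H

/-- The Green function, as an extended nonnegative number. -/
def GE (x y : ℝ × ℝ) : ENNReal := ENNReal.ofReal (G x y)

/-- The potential of a density with values in `[0, ∞]`. -/
def potE (f : ℝ × ℝ → ENNReal) (x : ℝ × ℝ) : ENNReal := ∫⁻ y, GE x y * f y ∂volH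

/-- The bilinear interaction energy of two densities with values in `[0, ∞]`. -/
def interE (f g : ℝ × ℝ → ENNReal) : ENNReal := ∫⁻ x, f x * potE g x ∂volH

/-- The impulse of a density with values in `[0, ∞]`. -/
def impE (f : ℝ × ℝ → ENNReal) : ENNReal := ∫⁻ x, ENNReal.ofReal x.2 * f x ∂volH

theorem GE_comm (x y : ℝ × ℝ) : GE x y = GE y x := by rw [GE, GE, G_comm]

theorem measurable_GE : Measurable (fun p : (ℝ × ℝ) × (ℝ × ℝ) => GE p.1 p.2) :=
  measurable_G.ennreal_ofReal

theorem measurable_GE_right (x : ℝ × ℝ) : Measurable (GE x) :=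
  Measurable.of_uncurry_left (f := GE) measurable_GE

theorem measurable_GE_mul (x : ℝ × ℝ) {f : ℝ × ℝ → ENNReal} (hf : Measurable f) :
    Measurable fun y => GE x y * f y := (measurable_GE_right x).mul hf

theorem measurable_height_mul {f : ℝ × ℝ → ENNReal} (hf : Measurable f) :
    Measurable fun x : ℝ × ℝ => ENNReal.ofReal x.2 * f x := by fun_prop

theorem ae_mem_H : ∀ᵐ x ∂volH, x ∈ H := ae_restrict_mem measurableSet_H

theorem measurable_potE {f : ℝ × ℝ → ENNReal} (hf : Measurable f) : Measurable (potE f) :=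
  (measurable_GE.mul (hf.comp measurable_snd)).lintegral_prod_right'

theorem interE_comm {f g : ℝ × ℝ → ENNReal} (hf : Measurable f) (hg : Measurable g) :
    interE f g = interE g f := by
  have h1 : ∀ f g : ℝ × ℝ → ENNReal, Measurable g →
      interE f g = ∫⁻ x, ∫⁻ y, f x * (GE x y * g y) ∂volH ∂volH := by
    intro f g hg
    refine lintegral_congr fun x => ?_
    rw [potE, lintegral_const_mul _ (measurable_GE_mul x hg)]
  rw [h1 f g hg, h1 g f hf, lintegral_lintegral_swap]
  · refine lintegral_congr fun x => lintegral_congr fun y => ?_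
    rw [GE_comm]; ring
  · exact ((hf.comp measurable_fst).mul
      (measurable_GE.mul (hg.comp measurable_snd))).aemeasurable

theorem potE_add {f : ℝ × ℝ → ENNReal} (hf : Measurable f) (g : ℝ × ℝ → ENNReal) (x : ℝ × ℝ) :
    potE (f + g) x = potE f x + potE g x := by
  simp only [potE, Pi.add_apply, mul_add]
  exact lintegral_add_left ((measurable_GE_right x).mul hf) _

theorem potE_mono {f g : ℝ × ℝ → ENNReal} (h : f ≤ g) (x : ℝ × ℝ) : potE f x ≤ potE g x :=
  lintegral_mono fun y => mul_le_mul_right (h y) _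

theorem interE_mono {f f' g g' : ℝ × ℝ → ENNReal} (h : f ≤ f') (h' : g ≤ g') :
    interE f g ≤ interE f' g' :=
  lintegral_mono fun x => mul_le_mul' (h x) (potE_mono h' x)

theorem interE_add_left {f : ℝ × ℝ → ENNReal} (f' : ℝ × ℝ → ENNReal) {g : ℝ × ℝ → ENNReal}
    (hf : Measurable f) (hg : Measurable g) :
    interE (f + f') g = interE f g + interE f' g := by
  simp only [interE, Pi.add_apply, add_mul]
  exact lintegral_add_left (hf.mul (measurable_potE hg)) _

theorem interE_add_right {f g g' : ℝ × ℝ → ENNReal}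
    (hf : Measurable f) (hg : Measurable g) :
    interE f (g + g') = interE f g + interE f g' := by
  simp only [interE, potE_add hg, mul_add]
  exact lintegral_add_left (hf.mul (measurable_potE hg)) _

theorem interE_add_self {f g : ℝ × ℝ → ENNReal} (hf : Measurable f) (hg : Measurable g) :
    interE (f + g) (f + g) = interE f f + 2 * interE f g + interE g g := by
  rw [interE_add_left _ hf (hf.add hg), interE_add_right hf hf, interE_add_right hg hf,
    interE_comm hg hf]
  ring

theorem impE_add {f : ℝ × ℝ → ENNReal} (hf : Measurable f) (g : ℝ × ℝ → ENNReal) :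
    impE (f + g) = impE f + impE g := by
  simp only [impE, Pi.add_apply, mul_add]
  exact lintegral_add_left (measurable_height_mul hf) _

theorem impE_mono {f g : ℝ × ℝ → ENNReal} (h : f ≤ g) : impE f ≤ impE g :=
  lintegral_mono fun y => mul_le_mul_right (h y) _

theorem interE_le_mul_impE {f g : ℝ × ℝ → ENNReal} {c : ENNReal} (hf : Measurable f)
    (h : ∀ x ∈ H, f x ≠ 0 → potE g x ≤ c * ENNReal.ofReal x.2) :
    interE f g ≤ c * impE f := by
  rw [impE, ← lintegral_const_mul _ (measurable_height_mul hf)]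
  refine lintegral_mono_ae ?_
  filter_upwards [ae_mem_H] with x hx
  by_cases h0 : f x = 0
  · simp [h0]
  · calc f x * potE g x ≤ f x * (c * ENNReal.ofReal x.2) := mul_le_mul_right (h x hx h0) _
      _ = _ := by ring

theorem potE_le {f : ℝ × ℝ → ENNReal} (hf : Measurable f) (hf1 : f ≤ 1) {x : ℝ × ℝ} (hx : x ∈ H)
    {s R : ℝ} (hs : 0 < s) (hR : 0 < R) :
    potE f x ≤ (ENNReal.ofReal ((R ^ 2)⁻¹) * impE f + ENNReal.ofReal (8 * s)
      + ENNReal.ofReal s⁻¹ * ∫⁻ y, (Metric.ball x R).indicator f y ∂volH) * ENNReal.ofReal x.2 := by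
  have hx2 : (0 : ℝ) ≤ x.2 := le_of_lt hx
  have m1 : Measurable fun y : ℝ × ℝ => ENNReal.ofReal y.2 * f y := by fun_prop
  have m2 : Measurable fun y : ℝ × ℝ => ENNReal.ofReal (‖x - y‖⁻¹) := by fun_prop
  have m3 : Measurable ((Metric.ball x R).indicator f) := hf.indicator measurableSet_ball
  have key : potE f x ≤ ∫⁻ y, ((ENNReal.ofReal ((R ^ 2)⁻¹) * (ENNReal.ofReal y.2 * f y)
      + (Metric.ball x s).indicator (fun y => ENNReal.ofReal (‖x - y‖⁻¹)) y)
      + ENNReal.ofReal s⁻¹ * (Metric.ball x R).indicator f y) * ENNReal.ofReal x.2 ∂volH := by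
    refine lintegral_mono_ae ?_
    filter_upwards [ae_mem_H] with y hy
    have hy2 : (0 : ℝ) ≤ y.2 := le_of_lt hy
    rw [mul_comm _ (ENNReal.ofReal x.2)]
    by_cases h1 : R ≤ ‖x - y‖
    · calc GE x y * f y ≤ ENNReal.ofReal (x.2 * ((R ^ 2)⁻¹ * y.2)) * f y :=
            mul_le_mul_left (ENNReal.ofReal_le_ofReal (G_le_mul_div_sq hx hy hR h1)) _
        _ = ENNReal.ofReal x.2 * (ENNReal.ofReal ((R ^ 2)⁻¹) * (ENNReal.ofReal y.2 * f y)) := by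
            rw [ENNReal.ofReal_mul hx2, ENNReal.ofReal_mul (by positivity)]; ring
        _ ≤ _ := by
            gcongr
            rw [add_assoc]
            exact le_self_add
    · have hb : y ∈ Metric.ball x R := by
        rw [Metric.mem_ball, dist_comm, dist_eq_norm]; exact not_le.1 h1
      have hG : GE x y ≤ ENNReal.ofReal x.2 * ENNReal.ofReal (‖x - y‖⁻¹) := by
        rw [← ENNReal.ofReal_mul hx2]
        exact ENNReal.ofReal_le_ofReal (G_le_div_norm hx hy)
      by_cases h2 : ‖x - y‖ < s
      · have hb2 : y ∈ Metric.ball x s := by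
          rw [Metric.mem_ball, dist_comm, dist_eq_norm]; exact h2
        rw [indicator_of_mem hb2]
        calc GE x y * f y ≤ GE x y * 1 := mul_le_mul_right (hf1 y) _
          _ ≤ ENNReal.ofReal x.2 * ENNReal.ofReal (‖x - y‖⁻¹) := by rwa [mul_one]
          _ ≤ _ := by
            gcongr
            exact le_add_self.trans le_self_add
      · rw [indicator_of_mem hb]
        calc GE x y * f y ≤ ENNReal.ofReal x.2 * ENNReal.ofReal (‖x - y‖⁻¹) * f y :=
              mul_le_mul_left hG _
          _ ≤ ENNReal.ofReal x.2 * ENNReal.ofReal s⁻¹ * f y := by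
              gcongr; exact not_lt.1 h2
          _ = ENNReal.ofReal x.2 * (ENNReal.ofReal s⁻¹ * f y) := by ring
          _ ≤ _ := by
            gcongr
            exact le_add_self
  refine key.trans ?_
  rw [lintegral_mul_const' _ _ ENNReal.ofReal_ne_top]
  gcongr
  rw [lintegral_add_right _ (m3.const_mul _),
    lintegral_add_right _ (m2.indicator measurableSet_ball), lintegral_const_mul _ m1,
    lintegral_const_mul _ m3]
  gcongr
  · exact le_rfl
  · rw [lintegral_indicator measurableSet_ball]
    refine le_trans ?_ (lintegral_ball_inv_norm_le x s hs)
    exact lintegral_mono' (Measure.restrict_mono le_rfl Measure.restrict_le_self) le_rfl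

theorem volume_ball_one (x : ℝ × ℝ) : volume (Metric.ball x 1) = 4 := by
  rw [show x = (x.1, x.2) from rfl, ← ball_prod_same, Measure.volume_eq_prod, Measure.prod_prod]
  simp only [Real.volume_ball]
  rw [← ENNReal.ofReal_mul (by norm_num)]; norm_num

theorem potE_le_const {f : ℝ × ℝ → ENNReal} (hf : Measurable f) (hf1 : f ≤ 1)
    (hJ : impE f ≤ 1) {x : ℝ × ℝ} (hx : x ∈ H) : potE f x ≤ 13 * ENNReal.ofReal x.2 := by
  refine (potE_le hf hf1 hx one_pos one_pos).trans ?_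
  gcongr
  have : ∫⁻ y, (Metric.ball x 1).indicator f y ∂volH ≤ 4 := by
    rw [lintegral_indicator measurableSet_ball]
    calc _ ≤ ∫⁻ y in Metric.ball x 1, 1 :=
          lintegral_mono' (Measure.restrict_mono le_rfl Measure.restrict_le_self) hf1
      _ = 4 := by simp [volume_ball_one]
  calc _ ≤ ENNReal.ofReal ((1 ^ 2)⁻¹) * 1 + ENNReal.ofReal (8 * 1) + ENNReal.ofReal 1⁻¹ * 4 := by
        gcongr
    _ = 13 := by norm_num

theorem mass_ball_le {f : ℝ × ℝ → ENNReal} (hf : Measurable f) (hf1 : f ≤ 1) (x : ℝ × ℝ)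
    {R ε : ℝ} (hR : 0 < R) (hε : 0 < ε) :
    ∫⁻ y, (Metric.ball x R).indicator f y ∂volH ≤
      ENNReal.ofReal (2 * R * ε) + ENNReal.ofReal ε⁻¹ * impE ((Metric.ball x R).indicator f) := by
  have m3 : Measurable ((Metric.ball x R).indicator f) := hf.indicator measurableSet_ball
  have m1 : Measurable fun y : ℝ × ℝ => ENNReal.ofReal y.2 * (Metric.ball x R).indicator f y := by
    fun_prop
  have ms : MeasurableSet (Ioo (x.1 - R) (x.1 + R) ×ˢ Ioo 0 ε) :=
    measurableSet_Ioo.prod measurableSet_Ioo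
  calc _ ≤ ∫⁻ y, ((Ioo (x.1 - R) (x.1 + R) ×ˢ Ioo 0 ε).indicator 1 y
        + ENNReal.ofReal ε⁻¹ * (ENNReal.ofReal y.2 * (Metric.ball x R).indicator f y)) ∂volH := by
        refine lintegral_mono_ae ?_
        filter_upwards [ae_mem_H] with y hy
        by_cases hb : y ∈ Metric.ball x R
        · by_cases hyε : y.2 < ε
          · have hy' : y ∈ Ioo (x.1 - R) (x.1 + R) ×ˢ Ioo 0 ε := by
              refine ⟨?_, hy, hyε⟩
              rw [show x = (x.1, x.2) from rfl, ← ball_prod_same] at hb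
              rw [← Real.ball_eq_Ioo]; exact hb.1
            rw [indicator_of_mem hb, indicator_of_mem hy']
            exact (hf1 y).trans le_self_add
          · refine le_trans ?_ le_add_self
            rw [← mul_assoc, ← ENNReal.ofReal_mul (by positivity)]
            refine le_mul_of_one_le_left' ?_
            rw [ENNReal.one_le_ofReal, ← div_eq_inv_mul, one_le_div hε]
            exact not_lt.1 hyε
        · rw [indicator_of_notMem hb]; exact zero_le
    _ = ∫⁻ y, (Ioo (x.1 - R) (x.1 + R) ×ˢ Ioo 0 ε).indicator 1 y ∂volH
        + ENNReal.ofReal ε⁻¹ * impE ((Metric.ball x R).indicator f) := by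
        rw [lintegral_add_right _ (m1.const_mul _), lintegral_const_mul _ m1, impE]
    _ ≤ _ := by
        gcongr
        rw [lintegral_indicator_one ms]
        refine (Measure.restrict_apply_le _ _).trans ?_
        rw [Measure.volume_eq_prod, Measure.prod_prod, Real.volume_Ioo, Real.volume_Ioo,
          ← ENNReal.ofReal_mul (by linarith)]
        apply ENNReal.ofReal_le_ofReal
        apply le_of_eq; ring

theorem mass_ball_le_of_high {f : ℝ × ℝ → ENNReal} (hf : Measurable f) {x : ℝ × ℝ}
    {R K : ℝ} (hK : 0 < K) (hx : R + K ≤ x.2) :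
    ∫⁻ y, (Metric.ball x R).indicator f y ∂volH ≤ ENNReal.ofReal K⁻¹ * impE f := by
  have m1 : Measurable fun y : ℝ × ℝ => ENNReal.ofReal y.2 * f y := by fun_prop
  rw [impE, ← lintegral_const_mul _ m1]
  refine lintegral_mono fun y => ?_
  by_cases hb : y ∈ Metric.ball x R
  · rw [indicator_of_mem hb, ← mul_assoc, ← ENNReal.ofReal_mul (by positivity)]
    refine le_mul_of_one_le_left' ?_
    rw [ENNReal.one_le_ofReal, ← div_eq_inv_mul, one_le_div hK]
    rw [show x = (x.1, x.2) from rfl, ← ball_prod_same] at hb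
    have := hb.2
    rw [Real.ball_eq_Ioo] at this
    linarith [this.1]
  · rw [indicator_of_notMem hb]; exact zero_le

/-- Where the potential is not small compared with the height, the density concentrates:
the height is bounded and the impulse in a ball of fixed radius is bounded below. -/
theorem potE_small_or_concentrated {η : ℝ} (hη : 0 < η) :
    ∃ R δ L : ℝ, 0 < R ∧ 0 < δ ∧ 0 < L ∧ ∀ f : ℝ × ℝ → ENNReal, Measurable f → f ≤ 1 →
      impE f ≤ 1 → ∀ x ∈ H, potE f x ≤ ENNReal.ofReal η * ENNReal.ofReal x.2 ∨
        (x.2 ≤ L ∧ ENNReal.ofReal δ ≤ impE ((Metric.ball x R).indicator f)) := by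
  obtain ⟨R, hR, hRη⟩ : ∃ R : ℝ, 0 < R ∧ (R ^ 2)⁻¹ = η / 4 := by
    refine ⟨2 / √η, by positivity, ?_⟩
    rw [div_pow, Real.sq_sqrt hη.le]; field_simp; norm_num
  set s := η / 32 with hs
  set κ := η * s / 2 with hκ
  set ε := κ / (4 * R) with hε
  have hs0 : 0 < s := by positivity
  have hκ0 : 0 < κ := by positivity
  have hε0 : 0 < ε := by positivity
  refine ⟨R, ε * κ / 2, R + κ⁻¹, hR, by positivity, by positivity, ?_⟩
  intro f hf hf1 hJ x hx
  by_contra! hcon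
  obtain ⟨hc1, hc2⟩ := hcon
  refine absurd hc1 (not_lt.2 ?_)
  have hM : ∫⁻ y, (Metric.ball x R).indicator f y ∂volH ≤ ENNReal.ofReal κ := by
    by_cases hxL : x.2 ≤ R + κ⁻¹
    · refine (mass_ball_le hf hf1 x hR hε0).trans ?_
      calc _ ≤ ENNReal.ofReal (2 * R * ε) + ENNReal.ofReal ε⁻¹ * ENNReal.ofReal (ε * κ / 2) := by
            gcongr; exact (hc2 hxL).le
        _ = ENNReal.ofReal κ := by
            rw [← ENNReal.ofReal_mul (by positivity), ← ENNReal.ofReal_add (by positivity)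
              (by positivity)]
            congr 1
            rw [hε]; field_simp; ring
    · refine (mass_ball_le_of_high hf (K := κ⁻¹) (by positivity) (not_le.1 hxL).le).trans ?_
      rw [inv_inv]
      calc _ ≤ ENNReal.ofReal κ * 1 := by gcongr
        _ = _ := mul_one _
  refine (potE_le hf hf1 hx hs0 hR).trans ?_
  gcongr
  calc _ ≤ ENNReal.ofReal ((R ^ 2)⁻¹) * 1 + ENNReal.ofReal (8 * s)
        + ENNReal.ofReal s⁻¹ * ENNReal.ofReal κ := by gcongr
    _ = ENNReal.ofReal η := by
        rw [mul_one, ← ENNReal.ofReal_mul (by positivity), ← ENNReal.ofReal_add (by positivity)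
              (by positivity), ← ENNReal.ofReal_add (by positivity) (by positivity)]
        congr 1
        rw [hRη, hκ, hs]; field_simp; ring

theorem lintegral_volH_comp_smul {t : ℝ} (ht : 0 < t) {φ : ℝ × ℝ → ENNReal} (hφ : Measurable φ) :
    ∫⁻ x, φ (t • x) ∂volH = ENNReal.ofReal ((t ^ 2)⁻¹) * ∫⁻ x, φ x ∂volH := by
  rw [← lintegral_indicator measurableSet_H, ← lintegral_indicator measurableSet_H]
  have h1 : ∀ x, H.indicator (fun x => φ (t • x)) x = H.indicator φ (t • x) := by
    intro x
    have : t • x ∈ H ↔ x ∈ H := by simp [H, ht]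
    by_cases hx : x ∈ H
    · rw [indicator_of_mem hx, indicator_of_mem (this.2 hx)]
    · rw [indicator_of_notMem hx, indicator_of_notMem (mt this.1 hx)]
  simp_rw [h1]
  rw [← lintegral_map (f := H.indicator φ) (g := fun x : ℝ × ℝ => t • x)
    (hφ.indicator measurableSet_H) (by fun_prop), Measure.map_addHaar_smul _ ht.ne',
    lintegral_smul_measure, smul_eq_mul]
  congr 2
  simp [abs_of_pos ht]

theorem lintegral_volH_comp_add (a : ℝ) {φ : ℝ × ℝ → ENNReal} :
    ∫⁻ x, φ (x + (a, 0)) ∂volH = ∫⁻ x, φ x ∂volH := by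
  rw [← lintegral_indicator measurableSet_H, ← lintegral_indicator measurableSet_H]
  have h1 : ∀ x, H.indicator (fun x => φ (x + (a, 0))) x = H.indicator φ (x + (a, 0)) := by
    intro x
    have : x + (a, 0) ∈ H ↔ x ∈ H := by simp [H]
    by_cases hx : x ∈ H
    · rw [indicator_of_mem hx, indicator_of_mem (this.2 hx)]
    · rw [indicator_of_notMem hx, indicator_of_notMem (mt this.1 hx)]
  simp_rw [h1]
  exact lintegral_add_right_eq_self (H.indicator φ) (a, 0)

theorem GE_smul {t : ℝ} (ht : 0 < t) (x y : ℝ × ℝ) : GE (t • x) (t • y) = GE x y := by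
  unfold GE G
  congr 4
  simp only [Prod.smul_fst, Prod.smul_snd, smul_eq_mul]
  rw [show 4 * (t * x.2) * (t * y.2) = t ^ 2 * (4 * x.2 * y.2) by ring,
    show (t * x.1 - t * y.1) ^ 2 + (t * x.2 - t * y.2) ^ 2 =
      t ^ 2 * ((x.1 - y.1) ^ 2 + (x.2 - y.2) ^ 2) by ring, mul_div_mul_left _ _ (by positivity)]

theorem GE_add (a : ℝ) (x y : ℝ × ℝ) : GE (x + (a, 0)) (y + (a, 0)) = GE x y := by
  simp [GE, G]

theorem impE_comp_smul {t : ℝ} (ht : 0 < t) {f : ℝ × ℝ → ENNReal} (hf : Measurable f) :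
    impE (fun x => f (t • x)) = ENNReal.ofReal ((t ^ 3)⁻¹) * impE f := by
  have h : ∀ x : ℝ × ℝ, ENNReal.ofReal x.2 * f (t • x)
      = ENNReal.ofReal t⁻¹ * (ENNReal.ofReal (t • x).2 * f (t • x)) := by
    intro x
    rw [← mul_assoc, ← ENNReal.ofReal_mul (by positivity), Prod.smul_snd, smul_eq_mul,
      inv_mul_cancel_left₀ ht.ne']
  unfold impE
  simp_rw [h]
  rw [lintegral_const_mul' _ _ ENNReal.ofReal_ne_top,
    lintegral_volH_comp_smul ht (measurable_height_mul hf), ← mul_assoc,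
    ← ENNReal.ofReal_mul (by positivity)]
  congr 2
  field_simp

theorem interE_comp_smul {t : ℝ} (ht : 0 < t) {f : ℝ × ℝ → ENNReal} (hf : Measurable f) :
    interE (fun x => f (t • x)) (fun x => f (t • x)) = ENNReal.ofReal ((t ^ 4)⁻¹) * interE f f := by
  have h : ∀ x : ℝ × ℝ, potE (fun x => f (t • x)) x
      = ENNReal.ofReal ((t ^ 2)⁻¹) * potE f (t • x) := by
    intro x
    unfold potE
    simp_rw [← GE_smul ht x]
    exact lintegral_volH_comp_smul ht (measurable_GE_mul (t • x) hf)
  unfold interE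
  have h' : ∀ x : ℝ × ℝ, f (t • x) * potE (fun x => f (t • x)) x
      = ENNReal.ofReal ((t ^ 2)⁻¹) * (f (t • x) * potE f (t • x)) := by
    intro x
    rw [h]; ring
  simp_rw [h']
  rw [lintegral_const_mul' _ _ ENNReal.ofReal_ne_top,
    lintegral_volH_comp_smul (φ := fun x => f x * potE f x) ht (hf.mul (measurable_potE hf)),
    ← mul_assoc, ← ENNReal.ofReal_mul (by positivity)]
  congr 2
  field_simp

theorem impE_comp_add (a : ℝ) (f : ℝ × ℝ → ENNReal) :
    impE (fun x => f (x + (a, 0))) = impE f := by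
  have := lintegral_volH_comp_add a (φ := fun x => ENNReal.ofReal x.2 * f x)
  simpa [impE] using this

theorem interE_comp_add (a : ℝ) (f : ℝ × ℝ → ENNReal) :
    interE (fun x => f (x + (a, 0))) (fun x => f (x + (a, 0))) = interE f f := by
  have h : ∀ x : ℝ × ℝ, potE (fun x => f (x + (a, 0))) x = potE f (x + (a, 0)) := by
    intro x
    unfold potE
    simp_rw [← GE_add a x]
    exact lintegral_volH_comp_add a (φ := fun y => GE (x + (a, 0)) y * f y)
  unfold interE
  simp_rw [h]
  exact lintegral_volH_comp_add a (φ := fun x => f x * potE f x)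

theorem volH_eq_volume {P : Set (ℝ × ℝ)} (hP : P ⊆ H) : volH P = volume P :=
  Measure.restrict_eq_self _ hP

theorem le_interE_indicator {P : Set (ℝ × ℝ)} (hP : MeasurableSet P) {c d : ℝ} (hc : 0 < c)
    (hPc : ∀ x ∈ P, c ≤ x.2) (hPd : ∀ x ∈ P, ∀ y ∈ P, ‖x - y‖ ≤ d) (a : ENNReal) :
    ENNReal.ofReal ((1 / (4 * π)) * Real.log (1 + 2 * c ^ 2 / d ^ 2)) * (a * volume P) ^ 2 ≤
      interE (P.indicator fun _ => a) (P.indicator fun _ => a) := by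
  set g := ENNReal.ofReal ((1 / (4 * π)) * Real.log (1 + 2 * c ^ 2 / d ^ 2)) with hg
  have hPH : P ⊆ H := fun x hx => hc.trans_le (hPc x hx)
  have h1 : ∀ x ∈ P, g * (a * volume P) ≤ potE (P.indicator fun _ => a) x := by
    intro x hx
    have hne : ∀ᵐ y ∂volH, y ≠ x := by simp [ae_iff]
    calc g * (a * volume P) = ∫⁻ y, P.indicator (fun _ => g * a) y ∂volH := by
          rw [lintegral_indicator_const hP, volH_eq_volume hPH, mul_assoc]
      _ ≤ _ := by
          refine lintegral_mono_ae ?_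
          filter_upwards [hne] with y hy
          by_cases hyP : y ∈ P
          · rw [indicator_of_mem hyP, indicator_of_mem hyP]
            gcongr
            exact ENNReal.ofReal_le_ofReal
              (log_le_G hc (hPc x hx) (hPc y hyP) hy.symm (hPd x hx y hyP))
          · simp [hyP]
  calc g * (a * volume P) ^ 2 = ∫⁻ x, P.indicator (fun _ => a * (g * (a * volume P))) x ∂volH := by
        rw [lintegral_indicator_const hP, volH_eq_volume hPH]; ring
    _ ≤ _ := by
        refine lintegral_mono fun x => ?_
        by_cases hx : x ∈ P
        · rw [indicator_of_mem hx, indicator_of_mem hx]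
          exact mul_le_mul_right (h1 x hx) _
        · simp [hx]

theorem interE_indicator_le {P Q : Set (ℝ × ℝ)} (hP : MeasurableSet P) (hQ : MeasurableSet Q)
    (hPH : P ⊆ H) (hQH : Q ⊆ H) {g : ℝ} (hg : ∀ x ∈ P, ∀ y ∈ Q, G x y ≤ g) (a b : ENNReal) :
    interE (P.indicator fun _ => a) (Q.indicator fun _ => b) ≤
      ENNReal.ofReal g * ((a * volume P) * (b * volume Q)) := by
  set g' := ENNReal.ofReal g with hg'
  have h1 : ∀ x ∈ P, potE (Q.indicator fun _ => b) x ≤ g' * (b * volume Q) := by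
    intro x hx
    calc _ ≤ ∫⁻ y, Q.indicator (fun _ => g' * b) y ∂volH := by
          refine lintegral_mono fun y => ?_
          by_cases hyQ : y ∈ Q
          · rw [indicator_of_mem hyQ, indicator_of_mem hyQ]
            gcongr
            exact ENNReal.ofReal_le_ofReal (hg x hx y hyQ)
          · simp [hyQ]
      _ = _ := by rw [lintegral_indicator_const hQ, volH_eq_volume hQH, mul_assoc]
  calc _ ≤ ∫⁻ x, P.indicator (fun _ => a * (g' * (b * volume Q))) x ∂volH := by
        refine lintegral_mono fun x => ?_
        by_cases hx : x ∈ P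
        · rw [indicator_of_mem hx, indicator_of_mem hx]
          exact mul_le_mul_right (h1 x hx) _
        · simp [hx]
    _ = _ := by rw [lintegral_indicator_const hP, volH_eq_volume hPH]; ring

/-- Densities between `0` and `1` with impulse at most `1`. -/
def Admissible (f : ℝ × ℝ → ENNReal) : Prop := Measurable f ∧ f ≤ 1 ∧ impE f ≤ 1

/-- The maximal interaction energy of the relaxed problem. -/
def supE : ENNReal := ⨆ (f) (_ : Admissible f), interE f f

theorem Admissible.interE_le {f : ℝ × ℝ → ENNReal} (hf : Admissible f) : interE f f ≤ supE :=
  le_iSup₂ (f := fun f (_ : Admissible f) => interE f f) f hf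

theorem Admissible.mono {f g : ℝ × ℝ → ENNReal} (hf : Admissible f) (hg : Measurable g)
    (h : g ≤ f) : Admissible g :=
  ⟨hg, h.trans hf.2.1, (impE_mono h).trans hf.2.2⟩

theorem Admissible.indicator {f : ℝ × ℝ → ENNReal} (hf : Admissible f) {s : Set (ℝ × ℝ)}
    (hs : MeasurableSet s) : Admissible (s.indicator f) :=
  hf.mono (hf.1.indicator hs) (indicator_le_self _ _)

theorem supE_ne_top : supE ≠ ⊤ := by
  have : supE ≤ 13 := by
    refine iSup₂_le fun f hf => ?_
    calc interE f f ≤ 13 * impE f :=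
          interE_le_mul_impE hf.1 fun x hx _ => potE_le_const hf.1 hf.2.1 hf.2.2 hx
      _ ≤ 13 * 1 := by gcongr; exact hf.2.2
      _ = 13 := mul_one _
  exact ne_top_of_le_ne_top (by norm_num) this

theorem supE_pos : 0 < supE := by
  set P : Set (ℝ × ℝ) := Ioo 0 1 ×ˢ Ioo (1 / 2) 1 with hPdef
  have hP : MeasurableSet P := measurableSet_Ioo.prod measurableSet_Ioo
  have hPH : P ⊆ H := fun x hx => lt_trans (by norm_num) hx.2.1
  have hvol : volume P = ENNReal.ofReal (1 / 2) := by
    rw [hPdef, Measure.volume_eq_prod, Measure.prod_prod, Real.volume_Ioo, Real.volume_Ioo,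
      ← ENNReal.ofReal_mul (by norm_num)]
    norm_num
  have hadm : Admissible (P.indicator fun _ => 1) := by
    refine ⟨measurable_const.indicator hP, indicator_le_self _ _, ?_⟩
    calc impE (P.indicator fun _ => 1) ≤ ∫⁻ x, P.indicator (fun _ => 1) x ∂volH := by
          refine lintegral_mono fun x => ?_
          by_cases hx : x ∈ P
          · rw [indicator_of_mem hx, mul_one]
            exact ENNReal.ofReal_le_one.2 hx.2.2.le
          · simp [hx]
      _ = ENNReal.ofReal (1 / 2) := by
          rw [lintegral_indicator_const hP, volH_eq_volume hPH, hvol, one_mul]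
      _ ≤ 1 := ENNReal.ofReal_le_one.2 (by norm_num)
  refine lt_of_lt_of_le ?_ ((le_interE_indicator hP (c := 1 / 2) (d := 1) (by norm_num)
    (fun x hx => hx.2.1.le) ?_ 1).trans hadm.interE_le)
  · rw [one_mul, hvol]
    refine ENNReal.mul_pos ?_ ?_
    · rw [ne_eq, ENNReal.ofReal_eq_zero, not_le]
      exact mul_pos (by positivity) (Real.log_pos (by norm_num))
    · simp
  · intro x hx y hy
    rw [Prod.norm_def]
    refine max_le ?_ ?_ <;> rw [Real.norm_eq_abs, abs_le] <;>
      constructor <;> simp only [Prod.fst_sub, Prod.snd_sub] <;>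
      linarith [hx.1.1, hx.1.2, hx.2.1, hx.2.2, hy.1.1, hy.1.2, hy.2.1, hy.2.2]

theorem interE_le_of_impE_le_cube {f : ℝ × ℝ → ENNReal} (hf : Measurable f) (hf1 : f ≤ 1) {t : ℝ}
    (ht : 0 < t) (hJ : impE f ≤ ENNReal.ofReal (t ^ 3)) :
    interE f f ≤ ENNReal.ofReal (t ^ 4) * supE := by
  have hadm : Admissible (fun x => f (t • x)) := by
    refine ⟨hf.comp (by fun_prop), fun x => hf1 _, ?_⟩
    rw [impE_comp_smul ht hf]
    calc _ ≤ ENNReal.ofReal ((t ^ 3)⁻¹) * ENNReal.ofReal (t ^ 3) := by gcongr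
      _ = 1 := by
        rw [← ENNReal.ofReal_mul (by positivity), inv_mul_cancel₀ (by positivity),
          ENNReal.ofReal_one]
  have h := hadm.interE_le
  rw [interE_comp_smul ht hf] at h
  calc interE f f = ENNReal.ofReal (t ^ 4) * (ENNReal.ofReal ((t ^ 4)⁻¹) * interE f f) := by
        rw [← mul_assoc, ← ENNReal.ofReal_mul (by positivity), mul_inv_cancel₀ (by positivity),
          ENNReal.ofReal_one, one_mul]
    _ ≤ _ := by gcongr

theorem exists_cube_eq {m : ENNReal} (hm0 : m ≠ 0) (hm1 : m ≤ 1) :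
    ∃ t : ℝ, 0 < t ∧ t ≤ 1 ∧ ENNReal.ofReal (t ^ 3) = m := by
  have hm : m ≠ ⊤ := ne_top_of_le_ne_top (by simp) hm1
  have hr : 0 < m.toReal := ENNReal.toReal_pos hm0 hm
  have hr1 : m.toReal ≤ 1 := ENNReal.toReal_le_of_le_ofReal zero_le_one (by simpa using hm1)
  refine ⟨m.toReal ^ ((3 : ℕ) : ℝ)⁻¹, by positivity, Real.rpow_le_one hr.le hr1 (by positivity), ?_⟩
  rw [Real.rpow_inv_natCast_pow hr.le (by norm_num), ENNReal.ofReal_toReal hm]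

theorem Admissible.interE_le_impE_mul {f : ℝ × ℝ → ENNReal} (hf : Admissible f) :
    interE f f ≤ impE f * supE := by
  by_cases h0 : impE f = 0
  · have : interE f f ≤ 13 * impE f :=
      interE_le_mul_impE hf.1 fun x hx _ => potE_le_const hf.1 hf.2.1 hf.2.2 hx
    rw [h0, mul_zero] at this
    exact this.trans zero_le
  · obtain ⟨t, ht, ht1, hm⟩ := exists_cube_eq h0 hf.2.2
    refine (interE_le_of_impE_le_cube hf.1 hf.2.1 ht hm.ge).trans ?_
    rw [← hm]
    gcongr ENNReal.ofReal ?_ * _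
    exact pow_le_pow_of_le_one ht.le ht1 (by norm_num)

/-- Strict superlinearity: a density whose energy is at least proportional to its impulse
has full impulse. -/
theorem Admissible.impE_eq_one {f : ℝ × ℝ → ENNReal} (hf : Admissible f) (h0 : impE f ≠ 0)
    (h : impE f * supE ≤ interE f f) : impE f = 1 := by
  obtain ⟨t, ht, ht1, hm⟩ := exists_cube_eq h0 hf.2.2
  have h2 := h.trans (interE_le_of_impE_le_cube hf.1 hf.2.1 ht hm.ge)
  rw [← hm, ENNReal.mul_le_mul_iff_left supE_pos.ne' supE_ne_top,
    ENNReal.ofReal_le_ofReal_iff (by positivity)] at h2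
  have h3 : 1 ≤ t := by
    by_contra! hlt
    have : t ^ 4 < t ^ 3 := pow_lt_pow_right_of_lt_one₀ ht hlt (by norm_num)
    linarith
  rw [← hm, le_antisymm ht1 h3]; simp

theorem tendsto_lintegral_mul_of_bounded_tests {X : Type*} [MeasurableSpace X] {m : Measure X}
    {f : ℕ → X → ENNReal} {F : X → ENNReal} (hf : ∀ n, Measurable (f n)) (hf1 : ∀ n, f n ≤ 1)
    (hF : Measurable F) (hF1 : F ≤ 1)
    (H0 : ∀ (N : ℕ) (g : X → ENNReal), Measurable g → (∀ x, g x ≤ N) →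
      Tendsto (fun n => ∫⁻ x, g x * f n x ∂m) atTop (𝓝 (∫⁻ x, g x * F x ∂m)))
    {g : X → ENNReal} (hg : Measurable g) (hgi : ∫⁻ x, g x ∂m ≠ ⊤) :
    Tendsto (fun n => ∫⁻ x, g x * f n x ∂m) atTop (𝓝 (∫⁻ x, g x * F x ∂m)) := by
  have hmin : ∀ x, Tendsto (fun N : ℕ => min (g x) (N : ENNReal)) atTop (𝓝 (g x)) := by
    intro x
    have : Tendsto (fun N : ℕ => min (g x) (N : ENNReal)) atTop (𝓝 (min (g x) ⊤)) :=
      tendsto_const_nhds.min ENNReal.tendsto_nat_nhds_top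
    simpa using this
  have hmono : ∀ x, Monotone (fun N : ℕ => min (g x) (N : ENNReal)) := by
    intro x a b hab
    exact min_le_min le_rfl (by exact_mod_cast hab)
  have hgN : ∀ N : ℕ, Measurable fun x => min (g x) (N : ENNReal) := fun N => hg.min measurable_const
  have lim1 : Tendsto (fun N : ℕ => ∫⁻ x, min (g x) (N : ENNReal) * F x ∂m) atTop
      (𝓝 (∫⁻ x, g x * F x ∂m)) := by
    refine lintegral_tendsto_of_tendsto_of_monotone (fun N => ((hgN N).mul hF).aemeasurable)
      (ae_of_all _ fun x a b hab => mul_le_mul_left (hmono x hab) _) (ae_of_all _ fun x => ?_)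
    exact ENNReal.Tendsto.mul_const (hmin x) (Or.inr (ne_top_of_le_ne_top (by simp) (hF1 x)))
  have lim2 : Tendsto (fun N : ℕ => ∫⁻ x, min (g x) (N : ENNReal) ∂m) atTop
      (𝓝 (∫⁻ x, g x ∂m)) :=
    lintegral_tendsto_of_tendsto_of_monotone (fun N => (hgN N).aemeasurable)
      (ae_of_all _ fun x a b hab => hmono x hab) (ae_of_all _ hmin)
  have lim3 : Tendsto (fun N : ℕ => ∫⁻ x, (g x - min (g x) (N : ENNReal)) ∂m) atTop (𝓝 0) := by
    have : ∀ N : ℕ, ∫⁻ x, (g x - min (g x) (N : ENNReal)) ∂m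
        = ∫⁻ x, g x ∂m - ∫⁻ x, min (g x) (N : ENNReal) ∂m := fun N =>
      lintegral_sub (hgN N) (ne_top_of_le_ne_top hgi (lintegral_mono fun x => min_le_left _ _))
        (ae_of_all _ fun x => min_le_left _ _)
    simp_rw [this]
    have h := ENNReal.Tendsto.sub (tendsto_const_nhds (x := ∫⁻ x, g x ∂m)) lim2 (Or.inl hgi)
    simpa using h
  refine tendsto_order.2 ⟨fun a ha => ?_, fun b hb => ?_⟩
  · obtain ⟨N, hN⟩ := ((tendsto_order.1 lim1).1 a ha).exists
    filter_upwards [(tendsto_order.1 (H0 N _ (hgN N) fun x => min_le_right _ _)).1 a hN] with n hn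
    exact hn.trans_le (lintegral_mono fun x => mul_le_mul_left (min_le_left _ _) _)
  · obtain ⟨N, hN⟩ := ((tendsto_order.1 lim3).2 _ (tsub_pos_of_lt hb)).exists
    have hN' : ∫⁻ x, min (g x) (N : ENNReal) * F x ∂m
        < b - ∫⁻ x, (g x - min (g x) (N : ENNReal)) ∂m := by
      refine lt_of_le_of_lt (lintegral_mono fun x => mul_le_mul_left (min_le_left _ _) _)
        (lt_tsub_iff_left.2 ?_)
      exact lt_tsub_iff_right.1 hN
    filter_upwards [(tendsto_order.1 (H0 N _ (hgN N) fun x => min_le_right _ _)).2 _ hN'] with n hn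
    refine lt_of_le_of_lt ?_ (lt_tsub_iff_right.1 hn)
    have hm : Measurable fun x => min (g x) (N : ENNReal) * f n x := (hgN N).mul (hf n)
    rw [← lintegral_add_left hm]
    refine lintegral_mono fun x => ?_
    calc g x * f n x = (min (g x) N + (g x - min (g x) N)) * f n x := by
          rw [add_tsub_cancel_of_le (min_le_left _ _)]
      _ ≤ _ := by
          rw [add_mul]
          gcongr
          exact mul_le_of_le_one_right' (hf1 n x)

theorem exists_weak_limit_of_isFiniteMeasure {X : Type*} [MeasurableSpace X]
    [MeasurableSpace.CountablyGenerated X] (m : Measure X) [IsFiniteMeasure m]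
    (f : ℕ → X → ENNReal) (hf : ∀ n, Measurable (f n)) (hf1 : ∀ n, f n ≤ 1) :
    ∃ (F : X → ENNReal) (φ : ℕ → ℕ), Measurable F ∧ F ≤ 1 ∧ StrictMono φ ∧
      ∀ (N : ℕ) (g : X → ENNReal), Measurable g → (∀ x, g x ≤ N) →
        Tendsto (fun n => ∫⁻ x, g x * f (φ n) x ∂m) atTop (𝓝 (∫⁻ x, g x * F x ∂m)) := by
  have hfR : ∀ n x, (f n x).toReal ≤ 1 := fun n x =>
    ENNReal.toReal_le_of_le_ofReal zero_le_one (by simpa using hf1 n x)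
  have hmem : ∀ n, MemLp (fun x => (f n x).toReal) 2 m := fun n =>
    MemLp.of_bound (hf n).ennreal_toReal.aestronglyMeasurable 1
      (ae_of_all _ fun x => by
        rw [Real.norm_of_nonneg ENNReal.toReal_nonneg]; exact hfR n x)
  let u : ℕ → Lp ℝ 2 m := fun n => (hmem n).toLp _
  obtain ⟨C, hC⟩ : ∃ C, ∀ n, ‖u n‖ ≤ C := by
    refine ⟨_, fun n => Lp.norm_le_of_ae_bound zero_le_one ?_⟩
    filter_upwards [(hmem n).coeFn_toLp] with x hx
    rw [hx, Real.norm_of_nonneg ENNReal.toReal_nonneg]; exact hfR n x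
  let T : ℕ → WeakDual ℝ (Lp ℝ 2 m) := fun n =>
    StrongDual.toWeakDual (InnerProductSpace.toDual ℝ (Lp ℝ 2 m) (u n))
  have hT : ∀ n, T n ∈ WeakDual.toStrongDual ⁻¹'
      Metric.closedBall (0 : StrongDual ℝ (Lp ℝ 2 m)) C := by
    intro n
    simp only [mem_preimage, mem_closedBall_zero_iff]
    refine le_trans (le_of_eq ?_) (hC n)
    exact (InnerProductSpace.toDual ℝ (Lp ℝ 2 m)).norm_map (u n)
  have : Fact ((2 : ENNReal) ≠ ⊤) := ⟨by norm_num⟩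
  obtain ⟨ℓ, -, φ, hφ, hlim⟩ := WeakDual.isSeqCompact_closedBall ℝ (Lp ℝ 2 m) 0 C hT
  set v : Lp ℝ 2 m := (InnerProductSpace.toDual ℝ (Lp ℝ 2 m)).symm (WeakDual.toStrongDual ℓ)
  have hw : ∀ w : Lp ℝ 2 m, Tendsto (fun n => inner ℝ (u (φ n)) w) atTop (𝓝 (inner ℝ v w)) := by
    intro w
    have h1 := (tendsto_iff_forall_eval_tendsto_topDualPairing.1 hlim) w
    have h2 : inner ℝ v w = ℓ w := InnerProductSpace.toDual_symm_apply
    rw [h2]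
    exact h1
  -- integrals against bounded tests
  have hwi : ∀ (h : X → ℝ), MemLp h 2 m →
      Tendsto (fun n => ∫ x, (f (φ n) x).toReal * h x ∂m) atTop (𝓝 (∫ x, v x * h x ∂m)) := by
    intro h hh
    have h1 := hw (hh.toLp h)
    simp only [L2.inner_def] at h1
    have e1 : ∀ n, ∫ x, inner ℝ (u (φ n) x) (hh.toLp h x) ∂m
        = ∫ x, (f (φ n) x).toReal * h x ∂m := by
      intro n
      refine integral_congr_ae ?_
      filter_upwards [(hmem (φ n)).coeFn_toLp, hh.coeFn_toLp] with x hx1 hx2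
      rw [hx2, show u (φ n) x = _ from hx1]
      simp [mul_comm]
    have e2 : ∫ x, inner ℝ (v x) (hh.toLp h x) ∂m = ∫ x, v x * h x ∂m := by
      refine integral_congr_ae ?_
      filter_upwards [hh.coeFn_toLp] with x hx2
      rw [hx2]; simp [mul_comm]
    simp_rw [e1] at h1
    rwa [e2] at h1
  have hvmem : MemLp v 2 m := Lp.memLp v
  have hvint : Integrable v m := hvmem.integrable (by norm_num)
  have hset : ∀ s, MeasurableSet s → Tendsto (fun n => ∫ x in s, (f (φ n) x).toReal ∂m) atTop
      (𝓝 (∫ x in s, v x ∂m)) := by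
    intro s hs
    have h1 := hwi (s.indicator fun _ => 1) ((memLp_const 1).indicator hs)
    have e : ∀ k : X → ℝ, ∫ x, k x * s.indicator (fun _ => 1) x ∂m = ∫ x in s, k x ∂m := by
      intro k
      rw [← integral_indicator hs]
      congr 1; ext x
      by_cases hx : x ∈ s <;> simp [hx]
    simpa only [e] using h1
  have hv0 : 0 ≤ᵐ[m] v := by
    refine ae_nonneg_of_forall_setIntegral_nonneg hvint fun s hs _ => ?_
    exact ge_of_tendsto' (hset s hs) fun n => integral_nonneg fun x => ENNReal.toReal_nonneg
  have hv1 : v ≤ᵐ[m] fun _ => (1 : ℝ) := by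
    refine ae_le_of_forall_setIntegral_le hvint (integrable_const 1) fun s hs _ => ?_
    refine le_of_tendsto' (hset s hs) fun n => ?_
    exact integral_mono ((hmem (φ n)).integrable (by norm_num)).integrableOn
      (integrable_const 1) fun x => hfR _ x
  refine ⟨fun x => min (ENNReal.ofReal (v x)) 1, φ,
    (Lp.stronglyMeasurable v).measurable.ennreal_ofReal.min measurable_const,
    fun x => min_le_right _ _, hφ, ?_⟩
  intro N g hg hgN
  have hgR : ∀ x, (g x).toReal ≤ N := fun x =>
    ENNReal.toReal_le_of_le_ofReal (by positivity) (by simpa using hgN x)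
  have hgt : ∀ x, g x ≠ ⊤ := fun x => ne_top_of_le_ne_top (by simp) (hgN x)
  have hft : ∀ n x, f n x ≠ ⊤ := fun n x => ne_top_of_le_ne_top (by simp) (hf1 n x)
  have hgmem : MemLp (fun x => (g x).toReal) 2 m :=
    MemLp.of_bound hg.ennreal_toReal.aestronglyMeasurable N
      (ae_of_all _ fun x => by
        rw [Real.norm_of_nonneg ENNReal.toReal_nonneg]; exact hgR x)
  have h1 := ENNReal.tendsto_ofReal (hwi _ hgmem)
  have e1 : ∀ n, ENNReal.ofReal (∫ x, (f (φ n) x).toReal * (g x).toReal ∂m)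
      = ∫⁻ x, g x * f (φ n) x ∂m := by
    intro n
    have hi : Integrable (fun x => (f (φ n) x).toReal * (g x).toReal) m :=
      (hmem (φ n)).integrable_mul hgmem
    rw [ofReal_integral_eq_lintegral_ofReal hi
      (ae_of_all _ fun x => mul_nonneg ENNReal.toReal_nonneg ENNReal.toReal_nonneg)]
    refine lintegral_congr fun x => ?_
    rw [ENNReal.ofReal_mul ENNReal.toReal_nonneg, ENNReal.ofReal_toReal (hgt x),
      ENNReal.ofReal_toReal (hft _ x), mul_comm]
  have e2 : ENNReal.ofReal (∫ x, v x * (g x).toReal ∂m)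
      = ∫⁻ x, g x * min (ENNReal.ofReal (v x)) 1 ∂m := by
    have hi : Integrable (fun x => v x * (g x).toReal) m := hvmem.integrable_mul hgmem
    rw [ofReal_integral_eq_lintegral_ofReal hi
      (by filter_upwards [hv0] with x hx; exact mul_nonneg hx ENNReal.toReal_nonneg)]
    refine lintegral_congr_ae ?_
    filter_upwards [hv0, hv1] with x hx0 hx1
    rw [ENNReal.ofReal_mul hx0, ENNReal.ofReal_toReal (hgt x),
      min_eq_left (ENNReal.ofReal_le_one.2 hx1), mul_comm]
  simp_rw [e1] at h1
  rwa [e2] at h1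

/-- Sequential weak-star compactness of the set of functions with values in `[0, 1]`. -/
theorem exists_weak_limit {X : Type*} [MeasurableSpace X]
    [MeasurableSpace.CountablyGenerated X] (μ : Measure X) [SigmaFinite μ]
    (f : ℕ → X → ENNReal) (hf : ∀ n, Measurable (f n)) (hf1 : ∀ n, f n ≤ 1) :
    ∃ (F : X → ENNReal) (φ : ℕ → ℕ), Measurable F ∧ F ≤ 1 ∧ StrictMono φ ∧
      ∀ g : X → ENNReal, Measurable g → ∫⁻ x, g x ∂μ ≠ ⊤ →
        Tendsto (fun n => ∫⁻ x, g x * f (φ n) x ∂μ) atTop (𝓝 (∫⁻ x, g x * F x ∂μ)) := by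
  obtain ⟨w, hw0, hwm, hwi⟩ := exists_pos_lintegral_lt_of_sigmaFinite μ one_ne_zero
  let W : X → ENNReal := fun x => w x
  have hW : Measurable W := hwm.coe_nnreal_ennreal
  have : IsFiniteMeasure (μ.withDensity W) := isFiniteMeasure_withDensity (hwi.trans (by simp)).ne
  obtain ⟨F, φ, hF, hF1, hφ, hlim⟩ := exists_weak_limit_of_isFiniteMeasure (μ.withDensity W) f hf hf1
  refine ⟨F, φ, hF, hF1, hφ, fun g hg hgi => ?_⟩
  have hW0 : ∀ x, W x ≠ 0 := fun x => by simpa [W] using (hw0 x).ne'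
  have hWt : ∀ x, W x ≠ ⊤ := fun x => ENNReal.coe_ne_top
  have key : ∀ k : X → ENNReal, Measurable k →
      ∫⁻ x, g x / W x * k x ∂(μ.withDensity W) = ∫⁻ x, g x * k x ∂μ := by
    intro k hk
    have hm : Measurable fun x => g x / W x * k x := (hg.div hW).mul hk
    rw [lintegral_withDensity_eq_lintegral_mul _ hW hm]
    refine lintegral_congr fun x => ?_
    simp only [Pi.mul_apply]
    rw [← mul_assoc, ENNReal.mul_div_cancel (hW0 x) (hWt x)]
  have h := tendsto_lintegral_mul_of_bounded_tests (fun n => hf (φ n)) (fun n => hf1 (φ n)) hF hF1 hlim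
    (hg.div hW) (by
      have := key (fun _ => 1) measurable_const
      simp only [mul_one] at this
      simpa only [Pi.div_apply, this] using hgi)
  simp only [Pi.div_apply] at h
  rw [key F hF] at h
  simpa only [key _ (hf _)] using h

theorem lintegral_indicator_ne_top_of_le {s : Set (ℝ × ℝ)} {ρ : ℝ} (hs : MeasurableSet s)
    (hsρ : s ⊆ Metric.ball 0 ρ) {g : ℝ × ℝ → ENNReal} {c : ENNReal} (hc : c ≠ ⊤)
    (hg : ∀ x ∈ H, g x ≤ c * ENNReal.ofReal x.2) :
    ∫⁻ x, s.indicator g x ∂volH ≠ ⊤ := by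
  have hle : ∫⁻ x, s.indicator g x ∂volH ≤
      ∫⁻ x in Metric.ball (0 : ℝ × ℝ) ρ, c * ENNReal.ofReal ρ := by
    rw [lintegral_indicator hs]
    calc ∫⁻ x in s, g x ∂volH ≤ ∫⁻ x in s, c * ENNReal.ofReal ρ ∂volH := by
          refine lintegral_mono_ae ?_
          filter_upwards [ae_restrict_mem hs, ae_restrict_of_ae ae_mem_H] with x hx hxH
          refine (hg x hxH).trans ?_
          gcongr
          have h1 : ‖x‖ < ρ := by simpa using hsρ hx
          exact ((le_abs_self _).trans (norm_snd_le x)).trans h1.le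
      _ ≤ _ := by
          refine lintegral_mono' ?_ le_rfl
          exact (Measure.restrict_mono hsρ le_rfl).trans
            (Measure.restrict_mono_measure Measure.restrict_le_self _)
  refine ne_top_of_le_ne_top ?_ hle
  rw [setLIntegral_const]
  exact ENNReal.mul_ne_top (ENNReal.mul_ne_top hc ENNReal.ofReal_ne_top) measure_ball_lt_top.ne

theorem indicator_mul_right_eq (s : Set (ℝ × ℝ)) (g f : ℝ × ℝ → ENNReal) (x : ℝ × ℝ) :
    g x * s.indicator f x = s.indicator g x * f x := by
  by_cases hx : x ∈ s <;> simp [hx]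

theorem tendsto_impE_ball {F : ℝ × ℝ → ENNReal} (hF : Measurable F) :
    Tendsto (fun k : ℕ => impE ((Metric.ball 0 (k : ℝ)).indicator F)) atTop (𝓝 (impE F)) := by
  refine lintegral_tendsto_of_tendsto_of_monotone
    (fun k => (measurable_height_mul (hF.indicator measurableSet_ball)).aemeasurable)
    (ae_of_all _ fun x a b hab => ?_) (ae_of_all _ fun x => ?_)
  · dsimp only
    gcongr
  · obtain ⟨N, hN⟩ := exists_nat_gt ‖x‖
    refine tendsto_const_nhds.congr' ?_
    filter_upwards [eventually_ge_atTop N] with k hk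
    have : x ∈ Metric.ball (0 : ℝ × ℝ) (k : ℝ) := by
      rw [mem_ball_zero_iff]; exact hN.trans_le (by exact_mod_cast hk)
    rw [indicator_of_mem this]

/-- Convergence of the integrals against every integrable test function. -/
def WeakLim (f : ℕ → ℝ × ℝ → ENNReal) (F : ℝ × ℝ → ENNReal) : Prop :=
  ∀ g : ℝ × ℝ → ENNReal, Measurable g → ∫⁻ x, g x ∂volH ≠ ⊤ →
    Tendsto (fun n => ∫⁻ x, g x * f n x ∂volH) atTop (𝓝 (∫⁻ x, g x * F x ∂volH))

section WeakLimits

variable {f : ℕ → ℝ × ℝ → ENNReal} {F : ℝ × ℝ → ENNReal} {s : Set (ℝ × ℝ)} {ρ : ℝ}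

theorem WeakLim.tendsto_impE (h : WeakLim f F) (hs : MeasurableSet s)
    (hsρ : s ⊆ Metric.ball 0 ρ) :
    Tendsto (fun n => impE (s.indicator (f n))) atTop (𝓝 (impE (s.indicator F))) := by
  unfold impE
  simp_rw [indicator_mul_right_eq s fun x : ℝ × ℝ => ENNReal.ofReal x.2]
  exact h _ (Measurable.indicator (by fun_prop) hs)
    (lintegral_indicator_ne_top_of_le hs hsρ ENNReal.one_ne_top fun x _ => by simp)

theorem WeakLim.admissible (h : WeakLim f F) (hf : ∀ n, Admissible (f n)) (hF : Measurable F)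
    (hF1 : F ≤ 1) : Admissible F := by
  refine ⟨hF, hF1, le_of_tendsto' (tendsto_impE_ball hF) fun k => ?_⟩
  exact le_of_tendsto' (h.tendsto_impE measurableSet_ball le_rfl) fun n =>
    ((hf n).indicator measurableSet_ball).2.2

theorem WeakLim.tendsto_potE (h : WeakLim f F) (hs : MeasurableSet s)
    (hsρ : s ⊆ Metric.ball 0 ρ) {x : ℝ × ℝ} (hx : x ∈ H) :
    Tendsto (fun n => potE (s.indicator (f n)) x) atTop (𝓝 (potE (s.indicator F) x)) := by
  unfold potE
  simp_rw [indicator_mul_right_eq s fun y : ℝ × ℝ => GE x y]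
  refine h _ ((measurable_GE_right x).indicator hs) ?_
  have hm : Measurable (s.indicator (1 : ℝ × ℝ → ENNReal)) := measurable_one.indicator hs
  have e : ∫⁻ y, s.indicator (fun y => GE x y) y ∂volH = potE (s.indicator 1) x :=
    lintegral_congr fun y => by simpa using (indicator_mul_right_eq s (fun y => GE x y) 1 y).symm
  rw [e]
  refine ne_top_of_le_ne_top ?_ (potE_le hm (indicator_le_self _ _) hx one_pos one_pos)
  have h1 : impE (s.indicator 1) ≠ ⊤ := by
    unfold impE
    simp_rw [indicator_mul_right_eq s fun x : ℝ × ℝ => ENNReal.ofReal x.2]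
    simpa using lintegral_indicator_ne_top_of_le hs hsρ ENNReal.one_ne_top
      (g := fun x => ENNReal.ofReal x.2) fun x _ => by simp
  have h2 : ∫⁻ y, (Metric.ball x 1).indicator (s.indicator 1) y ∂volH ≠ ⊤ := by
    refine ne_top_of_le_ne_top (measure_ball_lt_top (μ := volume) (x := x) (r := 1)).ne ?_
    calc _ ≤ ∫⁻ y, (Metric.ball x 1).indicator 1 y ∂volH := by
          gcongr; exact indicator_le_self s (1 : ℝ × ℝ → ENNReal) y
      _ = volH (Metric.ball x 1) := lintegral_indicator_one measurableSet_ball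
      _ ≤ _ := Measure.restrict_le_self _
  finiteness

theorem WeakLim.tendsto_interE (h : WeakLim f F) (hf : ∀ n, Admissible (f n))
    (hF : Admissible F) (hs : MeasurableSet s) (hsρ : s ⊆ Metric.ball 0 ρ) :
    Tendsto (fun n => interE (s.indicator (f n)) (s.indicator (f n))) atTop
      (𝓝 (interE (s.indicator F) (s.indicator F))) := by
  set T : ℕ → ℝ × ℝ → ENNReal := fun n => potE (s.indicator (f n))
  set S : ℝ × ℝ → ENNReal := potE (s.indicator F)
  have hT : ∀ n, Measurable (T n) := fun n => measurable_potE ((hf n).1.indicator hs)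
  have hS : Measurable S := measurable_potE (hF.1.indicator hs)
  have bd : ∀ {k}, Admissible k → ∀ x ∈ H, potE (s.indicator k) x ≤ 13 * ENNReal.ofReal x.2 :=
    fun hk x hx => potE_le_const (hk.indicator hs).1 (hk.indicator hs).2.1 (hk.indicator hs).2.2 hx
  have hB : ∫⁻ x, s.indicator (fun x => 13 * ENNReal.ofReal x.2) x ∂volH ≠ ⊤ :=
    lintegral_indicator_ne_top_of_le hs hsρ (c := 13) (by simp) fun x _ => le_rfl
  have hStop : ∀ x ∈ H, S x ≠ ⊤ := fun x hx => ne_top_of_le_ne_top (by finiteness) (bd hF x hx)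
  have dom : ∀ k : ℕ → ℝ × ℝ → ENNReal, (∀ n, Measurable (k n)) →
      (∀ n, ∀ x ∈ H, k n x ≤ 13 * ENNReal.ofReal x.2) →
      (∀ x ∈ H, Tendsto (fun n => k n x) atTop (𝓝 0)) →
      Tendsto (fun n => ∫⁻ x, s.indicator (k n) x ∂volH) atTop (𝓝 0) := by
    intro k hk hkb hk0
    have := tendsto_lintegral_of_dominated_convergence (μ := volH)
      (F := fun n => s.indicator (k n)) (f := fun _ => 0)
      (s.indicator fun x => 13 * ENNReal.ofReal x.2) (fun n => (hk n).indicator hs)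
      (fun n => by
        filter_upwards [ae_mem_H] with x hx
        exact indicator_le_indicator (hkb n x hx)) hB (by
        filter_upwards [ae_mem_H] with x hx
        by_cases hxs : x ∈ s
        · simpa [hxs] using hk0 x hx
        · simp [hxs])
    simpa using this
  have e1 := dom (fun n x => T n x - S x) (fun n => (hT n).sub hS)
    (fun n x hx => tsub_le_self.trans (bd (hf n) x hx)) fun x hx => by
      have := ENNReal.Tendsto.sub (h.tendsto_potE hs hsρ hx)
        (tendsto_const_nhds (x := S x)) (Or.inl (hStop x hx))
      rwa [tsub_self] at this
  have e2 := dom (fun n x => S x - T n x) (fun n => hS.sub (hT n))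
    (fun n x hx => tsub_le_self.trans (bd hF x hx)) fun x hx => by
      have := ENNReal.Tendsto.sub (tendsto_const_nhds (x := S x))
        (h.tendsto_potE hs hsρ hx) (Or.inl (hStop x hx))
      rwa [tsub_self] at this
  have hSint : ∫⁻ x, s.indicator S x ∂volH ≠ ⊤ :=
    lintegral_indicator_ne_top_of_le hs hsρ (c := 13) (by simp) (bd hF)
  have hb := h (s.indicator S) (hS.indicator hs) hSint
  have hlim : ∫⁻ x, s.indicator S x * F x ∂volH = interE (s.indicator F) (s.indicator F) := by
    unfold interE
    refine lintegral_congr fun x => ?_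
    rw [← indicator_mul_right_eq, mul_comm]
  rw [hlim] at hb
  have hfin : interE (s.indicator F) (s.indicator F) ≠ ⊤ :=
    ne_top_of_le_ne_top supE_ne_top (hF.indicator hs).interE_le
  have up := hb.add e1
  have lo := ENNReal.Tendsto.sub hb e2 (Or.inl hfin)
  rw [add_zero] at up
  rw [tsub_zero] at lo
  refine tendsto_of_tendsto_of_tendsto_of_le_of_le lo up (fun n => ?_) fun n => ?_
  · refine tsub_le_iff_right.2 ?_
    have hm : Measurable fun x => s.indicator (f n) x * T n x :=
      ((hf n).1.indicator hs).mul (hT n)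
    change _ ≤ ∫⁻ x, s.indicator (f n) x * T n x ∂volH + _
    rw [← lintegral_add_left hm]
    refine lintegral_mono fun x => ?_
    by_cases hx : x ∈ s
    · simp only [indicator_of_mem hx]
      calc S x * f n x ≤ (T n x + (S x - T n x)) * f n x := by gcongr; exact le_add_tsub
        _ ≤ f n x * T n x + (S x - T n x) := by
          rw [add_mul, mul_comm (T n x)]
          gcongr
          exact mul_le_of_le_one_right' ((hf n).2.1 x)
    · simp [hx]
  · have hm : Measurable fun x => s.indicator S x * f n x := (hS.indicator hs).mul (hf n).1
    change ∫⁻ x, s.indicator (f n) x * T n x ∂volH ≤ _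
    rw [← lintegral_add_left hm]
    refine lintegral_mono fun x => ?_
    by_cases hx : x ∈ s
    · simp only [indicator_of_mem hx]
      calc f n x * T n x ≤ f n x * (S x + (T n x - S x)) := by gcongr; exact le_add_tsub
        _ ≤ S x * f n x + (T n x - S x) := by
          rw [mul_add, mul_comm (S x)]
          gcongr
          exact mul_le_of_le_one_left' ((hf n).2.1 x)
    · simp [hx]

end WeakLimits

theorem impE_indicator_add_compl {f : ℝ × ℝ → ENNReal} (hf : Measurable f) {s : Set (ℝ × ℝ)}
    (hs : MeasurableSet s) : impE (s.indicator f) + impE (sᶜ.indicator f) = impE f := by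
  rw [← impE_add (hf.indicator hs), indicator_self_add_compl]

theorem tendsto_impE_compl_ball {F : ℝ × ℝ → ENNReal} (hF : Measurable F) (hfin : impE F ≠ ⊤) :
    Tendsto (fun k : ℕ => impE ((Metric.ball 0 (k : ℝ))ᶜ.indicator F)) atTop (𝓝 0) := by
  have e : ∀ k : ℕ, impE ((Metric.ball 0 (k : ℝ))ᶜ.indicator F)
      = impE F - impE ((Metric.ball 0 (k : ℝ)).indicator F) := by
    intro k
    rw [← impE_indicator_add_compl hF (s := Metric.ball 0 (k : ℝ)) measurableSet_ball,
      ENNReal.add_sub_cancel_left]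
    exact ne_top_of_le_ne_top hfin (impE_mono (indicator_le_self _ _))
  simp_rw [e]
  have := ENNReal.Tendsto.sub (tendsto_const_nhds (x := impE F)) (tendsto_impE_ball hF)
    (Or.inl hfin)
  rwa [tsub_self] at this

theorem potE_far_le {f : ℝ × ℝ → ENNReal} {x : ℝ × ℝ} (hx : x ∈ H) {d : ℝ} (hd : 0 < d)
    (h : ∀ y, f y ≠ 0 → d ≤ ‖x - y‖) (hf : Measurable f) :
    potE f x ≤ ENNReal.ofReal ((d ^ 2)⁻¹) * impE f * ENNReal.ofReal x.2 := by
  have hx2 : (0 : ℝ) ≤ x.2 := le_of_lt hx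
  rw [mul_assoc, mul_comm (impE f), ← mul_assoc, impE,
    ← lintegral_const_mul _ (measurable_height_mul hf)]
  refine lintegral_mono_ae ?_
  filter_upwards [ae_mem_H] with y hy
  by_cases h0 : f y = 0
  · simp [h0]
  rw [← mul_assoc, ← ENNReal.ofReal_mul (by positivity), ← ENNReal.ofReal_mul (by positivity)]
  gcongr
  refine ENNReal.ofReal_le_ofReal ((G_le_mul_div_sq hx hy hd (h y h0)).trans (le_of_eq ?_))
  ring

theorem Admissible.interE_split_le {f : ℝ × ℝ → ENNReal} (hf : Admissible f) {ρ : ℝ}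
    (hρ : 0 < ρ) :
    interE f f + impE ((Metric.ball 0 ρ).indicator f) * supE ≤
      interE ((Metric.ball 0 ρ).indicator f) ((Metric.ball 0 ρ).indicator f)
      + 2 * (13 * impE ((Metric.ball 0 (2 * ρ) \ Metric.ball 0 ρ).indicator f)
        + ENNReal.ofReal ((ρ ^ 2)⁻¹)) + supE := by
  set B : Set (ℝ × ℝ) := Metric.ball 0 ρ
  set C : Set (ℝ × ℝ) := Metric.ball 0 (2 * ρ)
  have hB : MeasurableSet B := measurableSet_ball
  have hC : MeasurableSet C := measurableSet_ball
  have hBC : B ⊆ C := Metric.ball_subset_ball (by linarith)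
  have ha := hf.indicator hB
  have hb := hf.indicator hB.compl
  have hc := hf.indicator (hC.diff hB)
  have hd := hf.indicator hC.compl
  have hsplit : Bᶜ.indicator f = (C \ B).indicator f + Cᶜ.indicator f := by
    ext x
    simp only [Pi.add_apply]
    by_cases h1 : x ∈ B
    · simp [h1, hBC h1]
    · by_cases h2 : x ∈ C <;> simp [h1, h2]
  have hac : interE (B.indicator f) ((C \ B).indicator f) ≤ 13 * impE ((C \ B).indicator f) := by
    rw [interE_comm ha.1 hc.1]
    exact interE_le_mul_impE hc.1 fun x hx _ => potE_le_const ha.1 ha.2.1 ha.2.2 hx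
  have had : interE (B.indicator f) (Cᶜ.indicator f) ≤ ENNReal.ofReal ((ρ ^ 2)⁻¹) := by
    calc _ ≤ ENNReal.ofReal ((ρ ^ 2)⁻¹) * impE (B.indicator f) := by
          refine interE_le_mul_impE ha.1 fun x hx h0 => ?_
          refine (potE_far_le hx hρ (fun y hy => ?_) hd.1).trans ?_
          · have hxB : ‖x‖ < ρ := by simpa [B] using mem_of_indicator_ne_zero h0
            have hyC : ¬ ‖y‖ < 2 * ρ := by simpa [C] using mem_of_indicator_ne_zero hy
            have := norm_sub_norm_le y x
            rw [norm_sub_rev]; linarith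
          · gcongr
            exact mul_le_of_le_one_right' hd.2.2
      _ ≤ _ := mul_le_of_le_one_right' ha.2.2
  have hff : interE f f = interE (B.indicator f) (B.indicator f)
      + 2 * interE (B.indicator f) (Bᶜ.indicator f)
      + interE (Bᶜ.indicator f) (Bᶜ.indicator f) := by
    rw [← interE_add_self ha.1 hb.1, indicator_self_add_compl]
  have hab : interE (B.indicator f) (Bᶜ.indicator f) ≤ 13 * impE ((C \ B).indicator f)
      + ENNReal.ofReal ((ρ ^ 2)⁻¹) := by
    rw [hsplit, interE_add_right ha.1 hc.1]
    exact add_le_add hac had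
  have himp : impE (Bᶜ.indicator f) * supE + impE (B.indicator f) * supE ≤ supE := by
    rw [← add_mul, add_comm, impE_indicator_add_compl hf.1 hB]
    exact mul_le_of_le_one_left' hf.2.2
  rw [hff, add_assoc]
  gcongr
  exact (add_le_add_left hb.interE_le_impE_mul _).trans himp

theorem WeakLim.isMaximizer {f : ℕ → ℝ × ℝ → ENNReal} {F : ℝ × ℝ → ENNReal} (h : WeakLim f F)
    (hf : ∀ n, Admissible (f n)) (hF : Admissible F)
    (hmax : Tendsto (fun n => interE (f n) (f n)) atTop (𝓝 supE)) :
    impE F * supE ≤ interE F F := by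
  have step : ∀ ρ : ℝ, 0 < ρ → impE ((Metric.ball 0 ρ).indicator F) * supE ≤ interE F F
      + 2 * (13 * impE ((Metric.ball 0 ρ)ᶜ.indicator F) + ENNReal.ofReal ((ρ ^ 2)⁻¹)) := by
    intro ρ hρ
    have lhs := hmax.add (ENNReal.Tendsto.mul_const (b := supE)
      (h.tendsto_impE (s := Metric.ball 0 ρ) measurableSet_ball le_rfl) (Or.inr supE_ne_top))
    have rhs := ((h.tendsto_interE hf hF (s := Metric.ball 0 ρ) measurableSet_ball le_rfl).add
      (ENNReal.Tendsto.const_mul (a := 2) ((ENNReal.Tendsto.const_mul (a := 13)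
        (h.tendsto_impE (s := Metric.ball 0 (2 * ρ) \ Metric.ball 0 ρ)
          (measurableSet_ball.diff measurableSet_ball) sdiff_subset)
          (Or.inr (by simp))).add_const (ENNReal.ofReal ((ρ ^ 2)⁻¹))) (Or.inr (by simp)))).add_const
        supE
    have := le_of_tendsto_of_tendsto' lhs rhs fun n => (hf n).interE_split_le hρ
    rw [add_comm, ENNReal.add_le_add_iff_right supE_ne_top] at this
    refine this.trans ?_
    gcongr
    · exact interE_mono (indicator_le_self _ _) (indicator_le_self _ _)
    · refine impE_mono (indicator_le_indicator_of_subset ?_ fun _ => zero_le)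
      exact fun x hx => hx.2
  have hfin : impE F ≠ ⊤ := ne_top_of_le_ne_top (by simp) hF.2.2
  have t1 := tendsto_impE_ball hF.1
  have t2 := tendsto_impE_compl_ball hF.1 hfin
  have t3 : Tendsto (fun k : ℕ => ENNReal.ofReal (((k : ℝ) ^ 2)⁻¹)) atTop (𝓝 0) := by
    rw [← ENNReal.ofReal_zero]
    refine ENNReal.tendsto_ofReal (tendsto_inv_atTop_zero.comp ?_)
    exact (tendsto_pow_atTop two_ne_zero).comp tendsto_natCast_atTop_atTop
  have lhs := ENNReal.Tendsto.mul_const (b := supE) t1 (Or.inr supE_ne_top)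
  have rhs := (ENNReal.Tendsto.const_mul (a := 2)
    ((ENNReal.Tendsto.const_mul (a := 13) t2 (Or.inr (by simp))).add t3)
    (Or.inr (by simp))).const_add (interE F F)
  simp only [mul_zero, add_zero] at rhs
  refine le_of_tendsto_of_tendsto lhs rhs ?_
  filter_upwards [eventually_gt_atTop 0] with k hk
  exact step k (by exact_mod_cast hk)

theorem exists_maximizing_seq : ∃ f : ℕ → ℝ × ℝ → ENNReal, (∀ n, Admissible (f n)) ∧
    Tendsto (fun n => interE (f n) (f n)) atTop (𝓝 supE) := by
  have e : supE = sSup ((fun f => interE f f) '' {f | Admissible f}) := by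
    rw [sSup_image]; rfl
  obtain ⟨u, -, hu, hmem⟩ := exists_seq_tendsto_sSup
    (S := (fun f => interE f f) '' {f | Admissible f})
    (by
      refine ⟨_, 0, ⟨measurable_zero, fun _ => zero_le, ?_⟩, rfl⟩
      simp [impE]) (OrderTop.bddAbove _)
  choose f hf hfu using hmem
  refine ⟨f, hf, ?_⟩
  simpa only [hfu, e] using hu

theorem exists_translate_concentrated : ∃ ρ δ : ℝ, 0 < δ ∧ ∀ f, Admissible f →
    supE / 2 < interE f f → ∃ g, Admissible g ∧ interE g g = interE f f ∧
      ENNReal.ofReal δ ≤ impE ((Metric.ball 0 ρ).indicator g) := by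
  have hhalf : supE / 2 ≠ ⊤ := (ENNReal.div_lt_top supE_ne_top (by simp)).ne
  have hη : 0 < (supE / 2).toReal :=
    ENNReal.toReal_pos (ENNReal.div_pos supE_pos.ne' (by simp)).ne' hhalf
  obtain ⟨R, δ, L, hR, hδ, hL, hconc⟩ := potE_small_or_concentrated hη
  refine ⟨R + L, δ, hδ, fun f hf hlt => ?_⟩
  obtain ⟨x, hx, hxL, hxδ⟩ : ∃ x ∈ H, x.2 ≤ L ∧
      ENNReal.ofReal δ ≤ impE ((Metric.ball x R).indicator f) := by
    by_contra hcon
    refine not_le.2 hlt ?_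
    calc interE f f ≤ ENNReal.ofReal (supE / 2).toReal * impE f :=
          interE_le_mul_impE hf.1 fun x hx _ =>
            (hconc f hf.1 hf.2.1 hf.2.2 x hx).resolve_right fun h => hcon ⟨x, hx, h⟩
      _ ≤ _ := by
          rw [ENNReal.ofReal_toReal hhalf]
          exact mul_le_of_le_one_right' hf.2.2
  refine ⟨fun y => f (y + (x.1, 0)), ⟨hf.1.comp (by fun_prop), fun y => hf.2.1 _, ?_⟩,
    interE_comp_add _ _, ?_⟩
  · rw [impE_comp_add]; exact hf.2.2
  · refine hxδ.trans ?_
    rw [← impE_comp_add x.1]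
    refine impE_mono fun y => ?_
    by_cases hy : y + (x.1, 0) ∈ Metric.ball x R
    · have hy' : y ∈ Metric.ball (0 : ℝ × ℝ) (R + L) := by
        rw [mem_ball_zero_iff]
        have h1 : ‖y + (x.1, 0) - x‖ < R := by simpa [dist_eq_norm] using hy
        have h2 : y = (y + (x.1, 0) - x) + (0, x.2) := by ext <;> simp
        have h3 : ‖((0 : ℝ), x.2)‖ ≤ L := by
          have : (0 : ℝ) < x.2 := hx
          simp [Prod.norm_def, abs_of_pos this, hxL, hL.le]
        rw [h2]
        exact (norm_add_le _ _).trans_lt (by linarith)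
      rw [indicator_of_mem hy, indicator_of_mem hy']
    · rw [indicator_of_notMem hy]; exact zero_le

theorem exists_maximizer : ∃ F, Admissible F ∧ impE F = 1 ∧ interE F F = supE := by
  obtain ⟨u, hu, hulim⟩ := exists_maximizing_seq
  obtain ⟨ρ, δ, hδ, hconc⟩ := exists_translate_concentrated
  have hev := hulim.eventually_const_lt (ENNReal.half_lt_self supE_pos.ne' supE_ne_top)
  obtain ⟨N, hN⟩ := eventually_atTop.1 hev
  choose f hf hfu hfδ using fun n : ℕ => hconc _ (hu (n + N)) (hN _ (Nat.le_add_left N n))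
  obtain ⟨F, φ, hFm, hF1, hφ, hlim⟩ := exists_weak_limit volH f (fun n => (hf n).1)
    fun n => (hf n).2.1
  have hw : WeakLim (fun n => f (φ n)) F := hlim
  have hF := hw.admissible (fun n => hf _) hFm hF1
  have hmax : Tendsto (fun n => interE (f (φ n)) (f (φ n))) atTop (𝓝 supE) := by
    simp_rw [hfu]
    exact hulim.comp ((tendsto_add_atTop_nat N).comp hφ.tendsto_atTop)
  have hle := hw.isMaximizer (fun n => hf _) hF hmax
  have hpos : impE F ≠ 0 := by
    have h1 : ENNReal.ofReal δ ≤ impE ((Metric.ball 0 ρ).indicator F) :=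
      ge_of_tendsto' (hw.tendsto_impE measurableSet_ball le_rfl) fun n => hfδ _
    exact ((ENNReal.ofReal_pos.2 hδ).trans_le
      (h1.trans (impE_mono (indicator_le_self _ _)))).ne'
  have h1 := hF.impE_eq_one hpos hle
  refine ⟨F, hF, h1, le_antisymm hF.interE_le ?_⟩
  rwa [h1, one_mul] at hle

theorem ae_eq_zero_of_impE_eq_zero {f : ℝ × ℝ → ENNReal} (hf : Measurable f) (h : impE f = 0) :
    ∀ᵐ x ∂volH, f x = 0 := by
  filter_upwards [(lintegral_eq_zero_iff (measurable_height_mul hf)).1 h, ae_mem_H] with x hx hxH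
  rcases mul_eq_zero.1 hx with h0 | h0
  · exact absurd (ENNReal.ofReal_eq_zero.1 h0) (not_le.2 hxH)
  · exact h0

theorem Admissible.exists_support_bound {F : ℝ × ℝ → ENNReal} (hF : Admissible F)
    (h1 : impE F = 1) (hmax : interE F F = supE) :
    ∃ ρ : ℝ, ∀ᵐ x ∂volH, x ∉ Metric.ball (0 : ℝ × ℝ) ρ → F x = 0 := by
  have hη4 : supE / 4 ≠ ⊤ := (ENNReal.div_lt_top supE_ne_top (by simp)).ne
  have hη : 0 < (supE / 4).toReal :=
    ENNReal.toReal_pos (ENNReal.div_pos supE_pos.ne' (by simp)).ne' hη4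
  obtain ⟨R, δ, L, hR, hδ, hL, hconc⟩ := potE_small_or_concentrated hη
  obtain ⟨k, hk⟩ := ((tendsto_impE_compl_ball hF.1 (by simp [h1])).eventually_lt_const
    (ENNReal.ofReal_pos.2 hδ)).exists
  refine ⟨k + R, ?_⟩
  set B : Set (ℝ × ℝ) := Metric.ball 0 (k + R)
  have hB : MeasurableSet B := measurableSet_ball
  have ha := hF.indicator hB
  have hb := hF.indicator hB.compl
  have hpot : ∀ x ∈ H, Bᶜ.indicator F x ≠ 0 → potE F x ≤ supE / 4 * ENNReal.ofReal x.2 := by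
    intro x hx h0
    rw [← ENNReal.ofReal_toReal hη4]
    refine (hconc F hF.1 hF.2.1 hF.2.2 x hx).resolve_right fun h => not_lt.2 h.2 ?_
    refine (impE_mono (indicator_le_indicator_of_subset (fun y hy => ?_) fun _ => zero_le)).trans_lt
      hk
    have hxB : ¬ ‖x‖ < k + R := by simpa [B] using mem_of_indicator_ne_zero h0
    have hy' : ‖y - x‖ < R := by simpa [dist_eq_norm] using hy
    have := norm_sub_norm_le x y
    rw [norm_sub_rev] at this
    simp only [mem_compl_iff, mem_ball_zero_iff]
    linarith
  have hFab : B.indicator F + Bᶜ.indicator F = F := indicator_self_add_compl B F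
  have e1 : interE F F ≤ interE (B.indicator F) (B.indicator F)
      + 2 * interE (Bᶜ.indicator F) F := by
    conv_lhs => rw [← hFab]
    rw [interE_add_self ha.1 hb.1, add_assoc]
    gcongr
    have : interE (Bᶜ.indicator F) F
        = interE (B.indicator F) (Bᶜ.indicator F) + interE (Bᶜ.indicator F) (Bᶜ.indicator F) := by
      conv_lhs => rw [← hFab, indicator_self_add_compl]
      nth_rewrite 2 [← hFab]
      rw [interE_add_right hb.1 ha.1, interE_comm hb.1 ha.1]
    rw [this, mul_add]
    gcongr
    exact le_mul_of_one_le_left' (by norm_num)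
  have e2 := interE_le_mul_impE hb.1 hpot
  have e3 := ha.interE_le_impE_mul
  have e4 : impE (B.indicator F) + impE (Bᶜ.indicator F) = 1 := by
    rw [impE_indicator_add_compl hF.1 hB, h1]
  have hb0 : impE (Bᶜ.indicator F) = 0 := by
    by_contra hne
    have hbt : impE (Bᶜ.indicator F) ≠ ⊤ := ne_top_of_le_ne_top (by simp) hb.2.2
    have hat : impE (B.indicator F) ≠ ⊤ := ne_top_of_le_ne_top (by simp) ha.2.2
    have e5 : impE (B.indicator F) * supE + impE (Bᶜ.indicator F) * supE ≤
        impE (B.indicator F) * supE + 2 * (supE / 4 * impE (Bᶜ.indicator F)) := by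
      rw [← add_mul, e4, one_mul]
      nth_rewrite 1 [← hmax]
      refine e1.trans ?_
      gcongr
    rw [ENNReal.add_le_add_iff_left (ENNReal.mul_ne_top hat supE_ne_top)] at e5
    have e6 : 2 * (supE / 4 * impE (Bᶜ.indicator F)) = impE (Bᶜ.indicator F) * (supE / 2) := by
      have : (2 : ENNReal) * (supE / 4) = supE / 2 := by
        rw [show (4 : ENNReal) = 2 * 2 by norm_num, ← ENNReal.mul_div_mul_left supE 2
          (c := 2) (by simp) (by simp), mul_div_assoc]
      rw [← mul_assoc, this, mul_comm]
    rw [e6, ENNReal.mul_le_mul_iff_right hne hbt] at e5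
    exact not_lt.2 e5 (ENNReal.half_lt_self supE_pos.ne' supE_ne_top)
  filter_upwards [ae_eq_zero_of_impE_eq_zero hb.1 hb0] with x hx hxB
  simpa [hxB] using hx

theorem interE_add_interE_le_of_isMaximizer {f p q : ℝ × ℝ → ENNReal} (hf : Measurable f)
    (hp : Measurable p) (hq : Measurable q) (hmax : interE (f + (p + q)) (f + (p + q)) = supE)
    (hpp : Admissible (f + (p + p))) (hqq : Admissible (f + (q + q))) :
    interE p p + interE q q ≤ 2 * interE p q := by
  have hp' := hpp.interE_le.trans hmax.ge
  have hq' := hqq.interE_le.trans hmax.ge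
  have hfin : interE (f + (p + q)) (f + (p + q)) ≠ ⊤ := hmax ▸ supE_ne_top
  have lf : f ≤ f + (p + q) := fun x => le_self_add
  have lp : p ≤ f + (p + q) := fun x => le_self_add.trans le_add_self
  have lq : q ≤ f + (p + q) := fun x => le_add_self.trans le_add_self
  have n1 := ne_top_of_le_ne_top hfin (interE_mono lf lf)
  have n2 := ne_top_of_le_ne_top hfin (interE_mono lf lp)
  have n3 := ne_top_of_le_ne_top hfin (interE_mono lf lq)
  have n4 := ne_top_of_le_ne_top hfin (interE_mono lp lp)
  have n5 := ne_top_of_le_ne_top hfin (interE_mono lq lq)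
  have n6 := ne_top_of_le_ne_top hfin (interE_mono lp lq)
  rw [interE_add_self hf (hp.add hp), interE_add_self hf (hp.add hq), interE_add_self hp hp,
    interE_add_self hp hq, interE_add_right hf hp, interE_add_right hf hp] at hp'
  rw [interE_add_self hf (hq.add hq), interE_add_self hf (hp.add hq), interE_add_self hq hq,
    interE_add_self hp hq, interE_add_right hf hp, interE_add_right hf hq] at hq'
  generalize interE f f = A at *
  generalize interE f p = B at *
  generalize interE f q = C at *
  generalize interE p p = D at *
  generalize interE q q = E at *
  generalize interE p q = K at *
  lift A to ℝ≥0 using n1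
  lift B to ℝ≥0 using n2
  lift C to ℝ≥0 using n3
  lift D to ℝ≥0 using n4
  lift E to ℝ≥0 using n5
  lift K to ℝ≥0 using n6
  norm_cast at *
  rw [← NNReal.coe_le_coe] at *
  push_cast at *
  linarith

theorem exists_ne_mem_forall_mem_nhds_pos {S : Set (ℝ × ℝ)} (hS : volume S ≠ 0) :
    ∃ p ∈ S, ∃ q ∈ S, p ≠ q ∧ ∀ r > 0, 0 < volume (S ∩ Metric.ball p r) ∧
      0 < volume (S ∩ Metric.ball q r) := by
  obtain ⟨p, hp, hp'⟩ := exists_mem_forall_mem_nhdsWithin_pos_measure hS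
  have hS' : volume (S \ {p}) ≠ 0 := by
    rwa [measure_sdiff_null (measure_singleton p)]
  obtain ⟨q, hq, hq'⟩ := exists_mem_forall_mem_nhdsWithin_pos_measure hS'
  refine ⟨p, hp, q, hq.1, fun h => hq.2 h.symm, fun r hr => ⟨hp' _ ?_, ?_⟩⟩
  · exact inter_mem self_mem_nhdsWithin (mem_nhdsWithin_of_mem_nhds (Metric.ball_mem_nhds p hr))
  · refine (hq' _ (inter_mem self_mem_nhdsWithin
      (mem_nhdsWithin_of_mem_nhds (Metric.ball_mem_nhds q hr)))).trans_le (measure_mono ?_)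
    exact inter_subset_inter_left _ sdiff_subset

theorem tendsto_log_one_add_div_sq {c : ℝ} (hc : 0 < c) :
    Tendsto (fun r : ℝ => (1 / (4 * π)) * Real.log (1 + 2 * c ^ 2 / (2 * r) ^ 2)) (𝓝[>] 0) atTop := by
  refine Tendsto.const_mul_atTop (by positivity) (Real.tendsto_log_atTop.comp ?_)
  refine tendsto_atTop_add_const_left _ _ ?_
  have h : Tendsto (fun r : ℝ => c ^ 2 / 2 * (r⁻¹) ^ 2) (𝓝[>] 0) atTop :=
    Tendsto.const_mul_atTop (by positivity)
      ((tendsto_pow_atTop two_ne_zero).comp tendsto_inv_nhdsGT_zero)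
  refine h.congr fun r => ?_
  rcases eq_or_ne r 0 with rfl | hr
  · simp
  · field_simp

/-- Two small disjoint patches on which the Green function is larger near each patch than between
the patches. -/
theorem exists_patches {S : Set (ℝ × ℝ)} (hSH : S ⊆ H) (hSm : MeasurableSet S)
    (hS : volume S ≠ 0) :
    ∃ P Q : Set (ℝ × ℝ), ∃ ρ c d g : ℝ, MeasurableSet P ∧ MeasurableSet Q ∧ P ⊆ S ∧ Q ⊆ S ∧
      Disjoint P Q ∧ volume P ≠ 0 ∧ volume Q ≠ 0 ∧ P ⊆ Metric.ball 0 ρ ∧ Q ⊆ Metric.ball 0 ρ ∧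
      0 < c ∧ (∀ x ∈ P, c ≤ x.2) ∧ (∀ x ∈ Q, c ≤ x.2) ∧ (∀ x ∈ P, ∀ y ∈ P, ‖x - y‖ ≤ d) ∧
      (∀ x ∈ Q, ∀ y ∈ Q, ‖x - y‖ ≤ d) ∧ (∀ x ∈ P, ∀ y ∈ Q, G x y ≤ g) ∧ 0 ≤ g ∧
      g < (1 / (4 * π)) * Real.log (1 + 2 * c ^ 2 / d ^ 2) := by
  obtain ⟨p, hp, q, hq, hpq, hpos⟩ := exists_ne_mem_forall_mem_nhds_pos hS
  have hp2 : 0 < p.2 := hSH hp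
  have hq2 : 0 < q.2 := hSH hq
  have hd0 : 0 < ‖p - q‖ := norm_pos_iff.2 (sub_ne_zero.2 hpq)
  set c : ℝ := min p.2 q.2 / 2 with hcdef
  have hc : 0 < c := by positivity
  have hcp : 2 * c ≤ p.2 := by rw [hcdef]; linarith [min_le_left p.2 q.2]
  have hcq : 2 * c ≤ q.2 := by rw [hcdef]; linarith [min_le_right p.2 q.2]
  set K : ℝ := p.2 + q.2 + c
  have hK : 0 < K := by positivity
  set g : ℝ := K * (((‖p - q‖ / 2) ^ 2)⁻¹ * K)
  have ev1 := (tendsto_log_one_add_div_sq hc).eventually_gt_atTop g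
  have ev2 : ∀ᶠ r : ℝ in 𝓝[>] 0, r < c := mem_nhdsWithin_of_mem_nhds (Iio_mem_nhds hc)
  have ev3 : ∀ᶠ r : ℝ in 𝓝[>] 0, r < ‖p - q‖ / 4 :=
    mem_nhdsWithin_of_mem_nhds (Iio_mem_nhds (by positivity))
  have ev4 : ∀ᶠ r : ℝ in 𝓝[>] 0, 0 < r := self_mem_nhdsWithin
  obtain ⟨r, hrg, hrc, hrd, hr⟩ := (ev1.and (ev2.and (ev3.and ev4))).exists
  have hball : ∀ z x : ℝ × ℝ, x ∈ Metric.ball z r → ‖x - z‖ < r := fun z x hx => by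
    simpa [dist_eq_norm] using hx
  have hsnd : ∀ z x : ℝ × ℝ, x ∈ Metric.ball z r → z.2 - c ≤ x.2 ∧ x.2 ≤ z.2 + c := by
    intro z x hx
    have h1 : |x.2 - z.2| ≤ ‖x - z‖ := norm_snd_le (x - z)
    have h2 := abs_le.1 (h1.trans ((hball z x hx).le.trans hrc.le))
    constructor <;> linarith [h2.1, h2.2]
  have hdiam : ∀ z x y : ℝ × ℝ, x ∈ Metric.ball z r → y ∈ Metric.ball z r → ‖x - y‖ ≤ 2 * r := by
    intro z x y hx hy
    have := norm_sub_le_norm_sub_add_norm_sub x z y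
    have h1 := hball z x hx
    have h2 := hball z y hy
    rw [norm_sub_rev] at h2
    linarith
  have hfar : ∀ x y : ℝ × ℝ, x ∈ Metric.ball p r → y ∈ Metric.ball q r →
      ‖p - q‖ / 2 ≤ ‖x - y‖ := by
    intro x y hx hy
    have h1 := hball p x hx
    have h2 := hball q y hy
    have h3 := norm_sub_le_norm_sub_add_norm_sub p x q
    have h4 := norm_sub_le_norm_sub_add_norm_sub x y q
    rw [norm_sub_rev] at h1
    linarith
  refine ⟨S ∩ Metric.ball p r, S ∩ Metric.ball q r, max (‖p‖ + r) (‖q‖ + r), c, 2 * r, g,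
    hSm.inter measurableSet_ball, hSm.inter measurableSet_ball, inter_subset_left,
    inter_subset_left, ?_, (hpos r hr).1.ne', (hpos r hr).2.ne', ?_, ?_, hc, ?_, ?_, ?_, ?_, ?_, ?_,
    hrg⟩
  · rw [Set.disjoint_left]
    intro x hx hy
    have := hfar x x hx.2 hy.2
    simp only [sub_self, norm_zero] at this
    linarith
  · refine inter_subset_right.trans (Metric.ball_subset_ball' ?_)
    rw [dist_zero_right, add_comm]; exact le_max_left _ _
  · refine inter_subset_right.trans (Metric.ball_subset_ball' ?_)
    rw [dist_zero_right, add_comm]; exact le_max_right _ _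
  · intro x hx; linarith [(hsnd p x hx.2).1]
  · intro x hx; linarith [(hsnd q x hx.2).1]
  · intro x hx y hy; exact hdiam p x y hx.2 hy.2
  · intro x hx y hy; exact hdiam q x y hx.2 hy.2
  · intro x hx y hy
    have hx0 : 0 < x.2 := hSH hx.1
    have hy0 : 0 < y.2 := hSH hy.1
    have hxK : x.2 ≤ K := by linarith [(hsnd p x hx.2).2]
    have hyK : y.2 ≤ K := by linarith [(hsnd q y hy.2).2]
    refine (G_le_mul_div_sq (hSH hx.1) (hSH hy.1) (by positivity) (hfar x y hx.2 hy.2)).trans ?_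
    change _ ≤ K * (((‖p - q‖ / 2) ^ 2)⁻¹ * K)
    gcongr
  · positivity

theorem impE_indicator_const {P : Set (ℝ × ℝ)} (hP : MeasurableSet P) (a : ENNReal) :
    impE (P.indicator fun _ => a) = a * impE (P.indicator 1) := by
  unfold impE
  rw [← lintegral_const_mul _ (measurable_height_mul (measurable_one.indicator hP))]
  refine lintegral_congr fun x => ?_
  by_cases hx : x ∈ P <;> simp [hx, mul_comm]

theorem impE_indicator_one_pos {P : Set (ℝ × ℝ)} (hP : MeasurableSet P) (hPH : P ⊆ H)
    (h : volume P ≠ 0) : impE (P.indicator 1) ≠ 0 := by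
  intro h0
  have h1 := ae_eq_zero_of_impE_eq_zero (measurable_one.indicator hP) h0
  refine h ?_
  rw [← volH_eq_volume hPH]
  refine measure_mono_null ?_ h1
  intro x hx
  simp [hx]

theorem impE_indicator_one_ne_top {P : Set (ℝ × ℝ)} (hP : MeasurableSet P) {ρ : ℝ}
    (h : P ⊆ Metric.ball 0 ρ) : impE (P.indicator 1) ≠ ⊤ := by
  unfold impE
  simp_rw [indicator_mul_right_eq P fun x : ℝ × ℝ => ENNReal.ofReal x.2]
  simpa using lintegral_indicator_ne_top_of_le hP h ENNReal.one_ne_top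
    (g := fun x => ENNReal.ofReal x.2) fun x _ => by simp

theorem exists_balanced {h k ε : ENNReal} (hh0 : h ≠ 0) (hht : h ≠ ⊤) (hk0 : k ≠ 0) (hkt : k ≠ ⊤)
    (hε : ε ≠ 0) : ∃ a b : ENNReal, a ≠ 0 ∧ b ≠ 0 ∧ a ≤ ε ∧ b ≤ ε ∧ a * h = b * k := by
  have hs : h + k ≠ ⊤ := by finiteness
  have hs0 : h + k ≠ 0 := by simp [hh0]
  refine ⟨ε * (k / (h + k)), ε * (h / (h + k)), mul_ne_zero hε (ENNReal.div_pos hk0 hs).ne',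
    mul_ne_zero hε (ENNReal.div_pos hh0 hs).ne', mul_le_of_le_one_right' ?_,
    mul_le_of_le_one_right' ?_, ?_⟩
  · exact ENNReal.div_le_of_le_mul (by rw [one_mul]; exact le_add_self)
  · exact ENNReal.div_le_of_le_mul (by rw [one_mul]; exact le_self_add)
  · simp only [div_eq_mul_inv]; ring

theorem Admissible.volume_intermediate_eq_zero {F : ℝ × ℝ → ENNReal} (hF : Admissible F)
    (hmax : interE F F = supE) {ε : ENNReal} (hε : ε ≠ 0) (hεt : ε ≠ ⊤) :
    volume (H ∩ {x | ε ≤ F x ∧ F x + ε ≤ 1}) = 0 := by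
  by_contra hS
  set S : Set (ℝ × ℝ) := H ∩ {x | ε ≤ F x ∧ F x + ε ≤ 1}
  have hSm : MeasurableSet S := measurableSet_H.inter
    ((measurableSet_le measurable_const hF.1).inter
      (measurableSet_le (hF.1.add measurable_const) measurable_const))
  have hSH : S ⊆ H := inter_subset_left
  obtain ⟨P, Q, ρ, c, d, g, hP, hQ, hPS, hQS, hPQ, hP0, hQ0, hPρ, hQρ, hc, hPc, hQc, hPd, hQd, hPQg,
    hg0, hg⟩ := exists_patches hSH hSm hS
  have hPH := hPS.trans hSH
  have hQH := hQS.trans hSH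
  obtain ⟨a, b, ha0, hb0, haε, hbε, hab⟩ := exists_balanced
    (impE_indicator_one_pos hP hPH hP0) (impE_indicator_one_ne_top hP hPρ)
    (impE_indicator_one_pos hQ hQH hQ0) (impE_indicator_one_ne_top hQ hQρ) hε
  set p : ℝ × ℝ → ENNReal := P.indicator fun _ => a with hpdef
  set q : ℝ × ℝ → ENNReal := Q.indicator fun _ => b with hqdef
  have hp : Measurable p := measurable_const.indicator hP
  have hq : Measurable q := measurable_const.indicator hQ
  have hpq : impE p = impE q := by
    rw [hpdef, hqdef, impE_indicator_const hP, impE_indicator_const hQ, hab]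
  have hcase : ∀ x, (p x = 0 ∧ q x = 0) ∨ (p x ≤ F x ∧ F x + p x ≤ 1 ∧ q x = 0) ∨
      (q x ≤ F x ∧ F x + q x ≤ 1 ∧ p x = 0) := by
    intro x
    by_cases hxP : x ∈ P
    · have hxQ : x ∉ Q := Set.disjoint_left.1 hPQ hxP
      have h := (hPS hxP).2
      right; left
      simp only [hpdef, hqdef, indicator_of_mem hxP, indicator_of_notMem hxQ, and_true]
      exact ⟨haε.trans h.1, (add_le_add_right haε _).trans h.2⟩
    · by_cases hxQ : x ∈ Q
      · have h := (hQS hxQ).2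
        right; right
        simp only [hpdef, hqdef, indicator_of_mem hxQ, indicator_of_notMem hxP, and_true]
        exact ⟨hbε.trans h.1, (add_le_add_right hbε _).trans h.2⟩
      · left; simp [hpdef, hqdef, hxP, hxQ]
  set f : ℝ × ℝ → ENNReal := F - (p + q) with hfdef
  have hf : Measurable f := hF.1.sub (hp.add hq)
  have hfF : f + (p + q) = F := by
    ext x
    simp only [hfdef, Pi.add_apply, Pi.sub_apply]
    refine tsub_add_cancel_of_le ?_
    rcases hcase x with h | h | h
    · simp [h.1, h.2]
    · simpa [h.2.2] using h.1
    · simpa [h.2.2] using h.1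
  have hFx : ∀ x, f x + (p x + q x) = F x := fun x => congrFun hfF x
  have himp : impE f + (impE p + impE q) ≤ 1 := by
    rw [← impE_add hp, ← impE_add hf, hfF]; exact hF.2.2
  have hpp : Admissible (f + (p + p)) := by
    refine ⟨hf.add (hp.add hp), fun x => ?_, ?_⟩
    · have := hFx x
      simp only [Pi.add_apply, Pi.one_apply, ← add_assoc]
      rcases hcase x with h | h | h
      · rw [h.1, h.2] at this
        simp only [h.1, add_zero] at this ⊢
        rw [this]; exact hF.2.1 x
      · rw [h.2.2, add_zero] at this
        rw [this]; exact h.2.1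
      · rw [h.2.2, zero_add] at this
        rw [h.2.2, add_zero, add_zero]
        exact (le_self_add.trans this.le).trans (hF.2.1 x)
    · rw [impE_add hf, impE_add hp]
      rwa [← hpq] at himp
  have hqq : Admissible (f + (q + q)) := by
    refine ⟨hf.add (hq.add hq), fun x => ?_, ?_⟩
    · have := hFx x
      simp only [Pi.add_apply, Pi.one_apply, ← add_assoc]
      rcases hcase x with h | h | h
      · rw [h.1, h.2] at this
        simp only [h.2, add_zero] at this ⊢
        rw [this]; exact hF.2.1 x
      · rw [h.2.2, add_zero] at this
        rw [h.2.2, add_zero, add_zero]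
        exact (le_self_add.trans this.le).trans (hF.2.1 x)
      · rw [h.2.2, zero_add] at this
        rw [this]; exact h.2.1
    · rw [impE_add hf, impE_add hq]
      rwa [hpq] at himp
  have key := interE_add_interE_le_of_isMaximizer hf hp hq (by rw [hfF, hmax]) hpp hqq
  have k1 := le_interE_indicator hP hc hPc hPd a
  have k2 := le_interE_indicator hQ hc hQc hQd b
  have k3 := interE_indicator_le hP hQ hPH hQH hPQg a b
  set g' : ℝ := (1 / (4 * π)) * Real.log (1 + 2 * c ^ 2 / d ^ 2)
  have hut : a * volume P ≠ ⊤ := ENNReal.mul_ne_top (ne_top_of_le_ne_top hεt haε)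
    (ne_top_of_le_ne_top measure_ball_lt_top.ne (measure_mono hPρ))
  have hvt : b * volume Q ≠ ⊤ := ENNReal.mul_ne_top (ne_top_of_le_ne_top hεt hbε)
    (ne_top_of_le_ne_top measure_ball_lt_top.ne (measure_mono hQρ))
  have hu0 : a * volume P ≠ 0 := mul_ne_zero ha0 hP0
  have tot := (add_le_add k1 k2).trans (key.trans (mul_le_mul_right k3 2))
  generalize a * volume P = u at *
  generalize b * volume Q = v at *
  have hur : 0 < u.toReal := ENNReal.toReal_pos hu0 hut
  have hvr : 0 ≤ v.toReal := ENNReal.toReal_nonneg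
  have hg' : 0 ≤ g' := hg0.trans hg.le
  have tot' := ENNReal.toReal_mono (by finiteness) tot
  rw [ENNReal.toReal_add (by finiteness) (by finiteness)] at tot'
  simp only [ENNReal.toReal_mul, ENNReal.toReal_pow, ENNReal.toReal_ofReal hg',
    ENNReal.toReal_ofReal hg0, ENNReal.toReal_ofNat] at tot'
  nlinarith [mul_nonneg hg0 (sq_nonneg (u.toReal - v.toReal)),
    mul_pos (sub_pos.2 hg) (pow_pos hur 2), mul_nonneg (sub_pos.2 hg).le (pow_nonneg hvr 2)]

theorem Admissible.ae_eq_zero_or_one {F : ℝ × ℝ → ENNReal} (hF : Admissible F)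
    (hmax : interE F F = supE) : ∀ᵐ x ∂volH, F x = 0 ∨ F x = 1 := by
  have h : ∀ n : ℕ, ∀ᵐ x ∂volH, ¬ (((n : ENNReal) + 1)⁻¹ ≤ F x ∧ F x + ((n : ENNReal) + 1)⁻¹ ≤ 1) := by
    intro n
    rw [ae_iff]
    simp only [not_not]
    rw [Measure.restrict_apply' measurableSet_H, inter_comm]
    exact hF.volume_intermediate_eq_zero hmax (by simp) (by simp)
  filter_upwards [ae_all_iff.2 h] with x hx
  by_contra hcon
  push Not at hcon
  have h1 : F x < 1 := lt_of_le_of_ne (hF.2.1 x) hcon.2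
  have hpos : 0 < min (F x) (1 - F x) := lt_min (pos_iff_ne_zero.2 hcon.1) (tsub_pos_of_lt h1)
  obtain ⟨n, hn⟩ := ENNReal.exists_inv_nat_lt hpos.ne'
  have hn' : ((n : ENNReal) + 1)⁻¹ ≤ min (F x) (1 - F x) :=
    (ENNReal.inv_le_inv.2 le_self_add).trans hn.le
  refine hx n ⟨hn'.trans (min_le_left _ _), ?_⟩
  have := hn'.trans (min_le_right _ _)
  calc F x + ((n : ENNReal) + 1)⁻¹ ≤ F x + (1 - F x) := by gcongr
    _ = 1 := add_tsub_cancel_of_le h1.le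

theorem interE_congr_ae {f g : ℝ × ℝ → ENNReal} (h : f =ᵐ[volH] g) : interE f f = interE g g := by
  have hp : ∀ x, potE f x = potE g x := fun x =>
    lintegral_congr_ae (h.mono fun y hy => by simp only [hy])
  exact lintegral_congr_ae (h.mono fun x hx => by simp only [hx, hp])

theorem impE_congr_ae {f g : ℝ × ℝ → ENNReal} (h : f =ᵐ[volH] g) : impE f = impE g :=
  lintegral_congr_ae (h.mono fun x hx => by simp only [hx])

theorem setIntegral_snd_eq_impE {A : Set (ℝ × ℝ)} (hA : MeasurableSet A) (hAH : A ⊆ H) :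
    ∫ x in A, x.2 = (impE (A.indicator 1)).toReal := by
  rw [integral_eq_lintegral_of_nonneg_ae
    ((ae_restrict_mem hA).mono fun x hx => le_of_lt (hAH hx)) (by fun_prop)]
  congr 1
  unfold impE
  simp_rw [indicator_mul_right_eq A fun x : ℝ × ℝ => ENNReal.ofReal x.2]
  simp only [Pi.one_apply, mul_one]
  rw [lintegral_indicator hA, Measure.restrict_restrict hA, inter_eq_self_of_subset_left hAH]

theorem energy_eq_interE {A : Set (ℝ × ℝ)} (hadm : Admissible (A.indicator 1)) {ω : ℝ × ℝ → ℝ}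
    (hω : ∀ᵐ x ∂volH, ω x = A.indicator (fun _ => (1 : ℝ)) x) :
    energy ω = (1 / 2) * (interE (A.indicator 1) (A.indicator 1)).toReal := by
  set f : ℝ × ℝ → ENNReal := A.indicator 1
  have hωf : ∀ᵐ x ∂volH, ω x = (f x).toReal := hω.mono fun x hx => by
    rw [hx]; by_cases h : x ∈ A <;> simp [f, h]
  have hf1 : ∀ x, f x < ⊤ := fun x => (hadm.2.1 x).trans_lt (by simp)
  have inner : ∀ᵐ x ∂volH, ∫ y in H, G x y * ω x * ω y = (f x * potE f x).toReal := by
    filter_upwards [hωf, ae_mem_H] with x hx hxH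
    have e : ∀ᵐ y ∂volH, G x y * ω x * ω y = (f x * (GE x y * f y)).toReal := by
      filter_upwards [hωf, ae_mem_H] with y hy hyH
      rw [hx, hy, ENNReal.toReal_mul, ENNReal.toReal_mul, GE, ENNReal.toReal_ofReal (G_nonneg hxH hyH)]
      ring
    have hm := measurable_GE_mul x hadm.1
    rw [integral_congr_ae e, integral_toReal (hm.const_mul _).aemeasurable
      (ae_of_all _ fun y => ENNReal.mul_lt_top (hf1 x)
        (ENNReal.mul_lt_top ENNReal.ofReal_lt_top (hf1 y))), lintegral_const_mul _ hm]
    rfl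
  have hm : Measurable fun x => f x * potE f x := hadm.1.mul (measurable_potE hadm.1)
  rw [energy, integral_congr_ae inner, integral_toReal hm.aemeasurable]
  · rfl
  · filter_upwards [ae_mem_H] with x hx
    exact ENNReal.mul_lt_top (hf1 x)
      ((potE_le_const hadm.1 hadm.2.1 hadm.2.2 hx).trans_lt (by finiteness))

theorem energy_le_of_memKinf {ω : ℝ × ℝ → ℝ} (h : memKinf 1 ω) :
    energy ω ≤ (1 / 2) * supE.toReal := by
  obtain ⟨-, A, hAH, hA, hω, hA1⟩ := h
  have himp : impE (A.indicator 1) = 1 := by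
    rwa [setIntegral_snd_eq_impE hA hAH, ENNReal.toReal_eq_one_iff] at hA1
  have hadm : Admissible (A.indicator 1) :=
    ⟨measurable_one.indicator hA, indicator_le_self _ _, himp.le⟩
  rw [energy_eq_interE hadm hω]
  gcongr
  · exact supE_ne_top
  · exact hadm.interE_le

theorem exists_memKinf_energy_eq : ∃ ω, memKinf 1 ω ∧ energy ω = (1 / 2) * supE.toReal := by
  obtain ⟨F, hF, hF1, hmax⟩ := exists_maximizer
  obtain ⟨ρ, hρ⟩ := hF.exists_support_bound hF1 hmax
  have h01 := hF.ae_eq_zero_or_one hmax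
  set A : Set (ℝ × ℝ) := {x | F x = 1} ∩ H
  have hA : MeasurableSet A := (hF.1 (measurableSet_singleton 1)).inter measurableSet_H
  have hAH : A ⊆ H := inter_subset_right
  have hAF : A.indicator 1 =ᵐ[volH] F := by
    filter_upwards [h01, ae_mem_H] with x hx hxH
    rcases hx with h | h
    · have : x ∉ A := fun hxA => by simpa [h] using hxA.1
      rw [indicator_of_notMem this, h]
    · rw [indicator_of_mem (show x ∈ A from ⟨h, hxH⟩), h]; rfl
  have hvol : volH A < ⊤ := by
    have : A ≤ᵐ[volH] Metric.ball (0 : ℝ × ℝ) ρ := by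
      filter_upwards [hρ] with x hx hxA
      by_contra hn
      have h1 : F x = 1 := hxA.1
      exact one_ne_zero (h1.symm.trans (hx hn))
    exact (measure_mono_ae this).trans_lt
      ((Measure.restrict_le_self _).trans_lt measure_ball_lt_top)
  have himp : impE (A.indicator 1) = 1 := by rw [impE_congr_ae hAF, hF1]
  have hadm : Admissible (A.indicator 1) :=
    ⟨measurable_one.indicator hA, indicator_le_self _ _, himp.le⟩
  refine ⟨A.indicator fun _ => 1, ⟨?_, A, hAH, hA, ae_of_all _ fun x => rfl, ?_⟩, ?_⟩
  · exact (integrable_indicator_iff hA).2 (integrableOn_const hvol.ne)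
  · rw [setIntegral_snd_eq_impE hA hAH, himp, ENNReal.toReal_one]
  · rw [energy_eq_interE hadm (ae_of_all _ fun x => rfl), interE_congr_ae hAF, hmax]

/-- `I_{1,∞}` is finite and attained. -/
theorem Iinf_finite_and_attained :
    BddAbove (energy '' {ω | memKinf 1 ω}) ∧
    ∃ ω : ℝ × ℝ → ℝ, memKinf 1 ω ∧
      ∀ ω' : ℝ × ℝ → ℝ, memKinf 1 ω' → energy ω' ≤ energy ω := by
  refine ⟨⟨(1 / 2) * supE.toReal, ?_⟩, ?_⟩
  · rintro _ ⟨ω, hω, rfl⟩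
    exact energy_le_of_memKinf hω
  · obtain ⟨ω, hω, hE⟩ := exists_memKinf_energy_eq
    exact ⟨ω, hω, fun ω' hω' => (energy_le_of_memKinf hω').trans hE.ge⟩
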